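/- arXiv:1202.1250 — 8 statements merged into one kernel-verified Lean document; each statement's English description precedes it below -/
import Mathlib

section
/- Let V be an oriented 4-dimensional real vector space with a volume form ε inducing the orientation, and let ⟨ω,φ⟩ be defined by ω∧φ = ⟨ω,φ⟩ε. A pair of 2-forms ω, φ ∈ Λ²V* is elliptic, i.e. ⟨ω,ω⟩⟨φ,φ⟩ > ⟨ω,φ⟩², if and only if for every pair of real numbers (λ₁,λ₂) ≠ (0,0) the 2-form λ₁ω + λ₂φ is symplectic (i.e. nondegenerate as a bilinear form on V). -/
open scoped TensorProduct

/-- The wedge product of an `m`-form and an `n`-form on a real vector space `V`,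
defined via `AlternatingMap.domCoprod` (sum over shuffles). -/
noncomputable def wedge {V : Type*} [AddCommGroup V] [Module ℝ V] {m n : ℕ}
    (ω : V [⋀^Fin m]→ₗ[ℝ] ℝ) (φ : V [⋀^Fin n]→ₗ[ℝ] ℝ) :
    V [⋀^Fin (m + n)]→ₗ[ℝ] ℝ :=
  (TensorProduct.lid ℝ ℝ).toLinearMap.compAlternatingMap
    ((ω.domCoprod φ).domDomCongr finSumFinEquiv)

/-- A `2`-form is symplectic if it is nondegenerate. -/
def IsSymplecticForm {V : Type*} [AddCommGroup V] [Module ℝ V]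
    (τ : V [⋀^Fin 2]→ₗ[ℝ] ℝ) : Prop :=
  ∀ v : V, v ≠ 0 → ∃ w : V, τ ![v, w] ≠ 0

theorem AlternatingMap.map_vec_two_swap {V : Type*} [AddCommGroup V] [Module ℝ V]
    (τ : V [⋀^Fin 2]→ₗ[ℝ] ℝ) (x y : V) : τ ![y, x] = -τ ![x, y] := by
  rw [← τ.map_swap ![x, y] (i := 0) (j := 1) (by decide)]
  congr 1; ext i; fin_cases i <;> rfl

/-- Four times the wedge of two `2`-forms is the full signed sum over permutations. -/
theorem four_mul_wedge_apply {V : Type*} [AddCommGroup V] [Module ℝ V]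
    (ω φ : V [⋀^Fin 2]→ₗ[ℝ] ℝ) (v : Fin 4 → V) :
    4 * wedge ω φ v = ∑ σ : Equiv.Perm (Fin 4), Equiv.Perm.sign σ •
      (ω ![v (σ 0), v (σ 1)] * φ ![v (σ 2), v (σ 3)]) := by
  have h := congrArg (fun f : V [⋀^Fin 2 ⊕ Fin 2]→ₗ[ℝ] (ℝ ⊗[ℝ] ℝ) =>
    TensorProduct.lid ℝ ℝ (f (v ∘ finSumFinEquiv)))
    (MultilinearMap.domCoprod_alternization_eq ω φ)
  simp only [MultilinearMap.alternatization_apply] at h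
  rw [← Equiv.sum_comp (Equiv.permCongr (finSumFinEquiv (m := 2) (n := 2)).symm)] at h
  simp only [map_sum, Units.smul_def, AlternatingMap.smul_apply, map_nsmul] at h
  have h4 : ((Fintype.card (Fin 2)).factorial * (Fintype.card (Fin 2)).factorial : ℕ) = 4 := rfl
  rw [h4, nsmul_eq_mul] at h
  refine h.symm.trans ?_
  refine Finset.sum_congr rfl fun σ _ => ?_
  simp only [MultilinearMap.domDomCongr_apply, MultilinearMap.domCoprod_apply, Units.smul_def,
    map_zsmul, TensorProduct.lid_tmul, Equiv.Perm.sign_permCongr, AlternatingMap.coe_multilinearMap,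
    smul_eq_mul]
  congr 3 <;> (ext i; fin_cases i <;> simp <;> rfl)

/-- The shuffle formula for the wedge of two `2`-forms. -/
theorem wedge_apply_two_two {V : Type*} [AddCommGroup V] [Module ℝ V]
    (ω φ : V [⋀^Fin 2]→ₗ[ℝ] ℝ) (v : Fin 4 → V) :
    wedge ω φ v =
      ω ![v 0, v 1] * φ ![v 2, v 3] - ω ![v 0, v 2] * φ ![v 1, v 3] +
      ω ![v 0, v 3] * φ ![v 1, v 2] + ω ![v 1, v 2] * φ ![v 0, v 3] -
      ω ![v 1, v 3] * φ ![v 0, v 2] + ω ![v 2, v 3] * φ ![v 0, v 1] := by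
  have h := four_mul_wedge_apply ω φ v
  have expand {n : ℕ} (f : Equiv.Perm (Fin (n + 1)) → ℝ) :
      ∑ σ, f σ = ∑ i, ∑ τ, f (Equiv.Perm.decomposeFin.symm (i, τ)) := by
    rw [← Equiv.sum_comp Equiv.Perm.decomposeFin.symm, Fintype.sum_prod_type]
  have apply_two {n : ℕ} (p : Fin (n + 3)) (e : Equiv.Perm (Fin (n + 2))) :
      Equiv.Perm.decomposeFin.symm (p, e) 2 = Equiv.swap 0 p (e 1).succ :=
    Equiv.Perm.decomposeFin_symm_apply_succ e p 1
  have apply_three (p : Fin 4) (e : Equiv.Perm (Fin 3)) :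
      Equiv.Perm.decomposeFin.symm (p, e) 3 = Equiv.swap 0 p (e 2).succ :=
    Equiv.Perm.decomposeFin_symm_apply_succ e p 2
  simp only [expand, Fin.sum_univ_succ (n := 3), Fin.sum_univ_three, Fin.sum_univ_two,
    Fin.sum_univ_one, Equiv.Perm.decomposeFin.symm_sign, Equiv.Perm.decomposeFin_symm_apply_zero,
    Equiv.Perm.decomposeFin_symm_apply_one, apply_two, apply_three] at h
  simp [Equiv.swap_apply_def] at h
  rw [ω.map_vec_two_swap (v 0) (v 1), ω.map_vec_two_swap (v 0) (v 2), ω.map_vec_two_swap (v 0) (v 3),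
    ω.map_vec_two_swap (v 1) (v 2), ω.map_vec_two_swap (v 1) (v 3), ω.map_vec_two_swap (v 2) (v 3),
    φ.map_vec_two_swap (v 0) (v 1), φ.map_vec_two_swap (v 0) (v 2), φ.map_vec_two_swap (v 0) (v 3),
    φ.map_vec_two_swap (v 1) (v 2), φ.map_vec_two_swap (v 1) (v 3), φ.map_vec_two_swap (v 2) (v 3)] at h
  linarith

namespace AlternatingMap

variable {V : Type*} [AddCommGroup V] [Module ℝ V] (τ : V [⋀^Fin 2]→ₗ[ℝ] ℝ)

/-- The bilinear form underlying an alternating `2`-form. -/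
noncomputable def toBilinForm : LinearMap.BilinForm ℝ V :=
  LinearMap.mk₂ ℝ (fun x y => τ ![x, y])
    (fun x x' y => τ.map_vecCons_add ![y] x x')
    (fun c x y => τ.map_vecCons_smul ![y] c x)
    (fun x y y' => by
      simp only [τ.map_vec_two_swap _ x]
      rw [← neg_add]; exact congrArg _ (τ.map_vecCons_add ![x] y y'))
    (fun c x y => by
      simp only [τ.map_vec_two_swap _ x, smul_neg]
      exact congrArg _ (τ.map_vecCons_smul ![x] c y))

end AlternatingMap

/-- A `2`-form on a `4`-dimensional space is symplectic if and only if its square is nonzero. -/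
theorem isSymplecticForm_iff_wedge_self_ne_zero {V : Type*} [AddCommGroup V] [Module ℝ V]
    (b : Module.Basis (Fin 4) ℝ V) (τ : V [⋀^Fin 2]→ₗ[ℝ] ℝ) :
    IsSymplecticForm τ ↔ wedge τ τ b ≠ 0 := by
  have hsep : IsSymplecticForm τ ↔ τ.toBilinForm.SeparatingLeft := by
    refine forall_congr' fun v => ?_
    rw [← not_imp_not]; simp [AlternatingMap.toBilinForm]
  have hdet : (LinearMap.toMatrix₂ b b τ.toBilinForm).det = (wedge τ τ b / 2) ^ 2 := by
    have diag (x : V) : τ ![x, x] = 0 := by linarith [τ.map_vec_two_swap x x]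
    rw [wedge_apply_two_two, Matrix.det_succ_row_zero]
    simp [Matrix.det_fin_three, Fin.sum_univ_succ, LinearMap.toMatrix₂_apply,
      AlternatingMap.toBilinForm, Fin.succAbove, diag]
    rw [τ.map_vec_two_swap (b 0) (b 1), τ.map_vec_two_swap (b 0) (b 2), τ.map_vec_two_swap (b 0) (b 3),
      τ.map_vec_two_swap (b 1) (b 2), τ.map_vec_two_swap (b 1) (b 3), τ.map_vec_two_swap (b 2) (b 3)]
    ring
  rw [hsep, LinearMap.separatingLeft_iff_det_ne_zero b, hdet]
  simp

/-- A real binary quadratic form is definite if and only if it has no nontrivial zero. -/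
theorem sq_lt_mul_iff_forall_ne_zero (p q r : ℝ) :
    q ^ 2 < p * r ↔
      ∀ x y : ℝ, ¬(x = 0 ∧ y = 0) → p * x ^ 2 + 2 * q * (x * y) + r * y ^ 2 ≠ 0 := by
  constructor
  · intro h x y hxy h0
    have h1 : (p * x + q * y) ^ 2 + (p * r - q ^ 2) * y ^ 2 = 0 := by linear_combination p * h0
    have hy : y = 0 := by
      by_contra hy
      nlinarith [mul_pos (sub_pos.2 h) (pow_pos (abs_pos.2 hy) 2), sq_abs y,
        sq_nonneg (p * x + q * y)]
    subst hy
    have hp : p ≠ 0 := by rintro rfl; nlinarith [sq_nonneg q]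
    simp_all
  · intro h
    by_contra! hle
    by_cases hp : p = 0
    · exact h 1 0 (by simp) (by simp [hp])
    · refine h (-q + √(q ^ 2 - p * r)) p (by simp [hp]) ?_
      linear_combination p * Real.sq_sqrt (sub_nonneg.2 hle)

/-- a pair of `2`-forms `(ω,φ)` on an oriented `4`-dimensional real
vector space is elliptic, i.e. `⟨ω,ω⟩⟨φ,φ⟩ > ⟨ω,φ⟩²`, if and only if every nonzero
linear combination `λ₁ω + λ₂φ` is symplectic. -/
theorem stmt1 {V : Type*} [AddCommGroup V] [Module ℝ V]
    [FiniteDimensional ℝ V] (hV : Module.finrank ℝ V = 4)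
    (o : Orientation ℝ V (Fin 4))
    (ε : V [⋀^Fin 4]→ₗ[ℝ] ℝ) (hε : ε ≠ 0)
    (hor : rayOfNeZero ℝ ε hε = o)
    (B : (V [⋀^Fin 2]→ₗ[ℝ] ℝ) → (V [⋀^Fin 2]→ₗ[ℝ] ℝ) → ℝ)
    (hB : ∀ ω φ : V [⋀^Fin 2]→ₗ[ℝ] ℝ, wedge ω φ = B ω φ • ε)
    (ω φ : V [⋀^Fin 2]→ₗ[ℝ] ℝ) :
    B ω ω * B φ φ > (B ω φ) ^ 2 ↔
      ∀ lam₁ lam₂ : ℝ, ¬(lam₁ = 0 ∧ lam₂ = 0) →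
        IsSymplecticForm (lam₁ • ω + lam₂ • φ) := by
  let b := Module.finBasisOfFinrankEq ℝ V hV
  have hb : ε b ≠ 0 := (ε.map_basis_ne_zero_iff b).2 hε
  have key (α β) : B α β = wedge α β b / ε b := by
    rw [hB]; simp [hb]
  rw [gt_iff_lt, sq_lt_mul_iff_forall_ne_zero]
  refine forall₂_congr fun x y => imp_congr_right fun _ => ?_
  rw [isSymplecticForm_iff_wedge_self_ne_zero b, not_iff_not]
  have expand : wedge (x • ω + y • φ) (x • ω + y • φ) b =
      (B ω ω * x ^ 2 + 2 * B ω φ * (x * y) + B φ φ * y ^ 2) * ε b := by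
    simp only [key]
    field_simp
    simp only [wedge_apply_two_two, AlternatingMap.add_apply, AlternatingMap.smul_apply,
      smul_eq_mul]
    ring
  simp [expand, hb]
end

section
/- Let V be an oriented 4-dimensional real vector space, let ω be a symplectic 2-form on V, and let φ, φ′ ∈ Λ²V* satisfy ω∧φ = 0 and ω∧φ′ = 0, with both pairs (ω,φ) and (ω,φ′) elliptic. Then there exists a linear isomorphism A : V → V with A*ω = ω and A*φ = φ′ if and only if φ∧φ = φ′∧φ′. -/
open scoped TensorProduct

section

theorem Equiv.Perm.sum_fin_succ {M : Type*} [AddCommMonoid M] {n : ℕ}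
    (f : Equiv.Perm (Fin (n + 1)) → M) :
    ∑ σ, f σ = ∑ i, ∑ τ, f (Equiv.Perm.decomposeFin.symm (i, τ)) := by
  rw [← Equiv.sum_comp Equiv.Perm.decomposeFin.symm, Fintype.sum_prod_type]

variable {V : Type*} [AddCommGroup V] [Module ℝ V]

theorem AlternatingMap.apply_pair_swap (α : V [⋀^Fin 2]→ₗ[ℝ] ℝ) (x y : V) :
    α ![y, x] = -α ![x, y] := by
  simpa using α.map_swap ![x, y] (i := 0) (j := 1) (by decide)

theorem four_mul_wedge_two_two_apply (α β : V [⋀^Fin 2]→ₗ[ℝ] ℝ) (v : Fin 4 → V) :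
    4 * wedge α β v = ∑ σ : Equiv.Perm (Fin 4), ((Equiv.Perm.sign σ : ℤ) : ℝ) *
      (α ![v (σ 0), v (σ 1)] * β ![v (σ 2), v (σ 3)]) := by
  have h := congrArg (fun f => TensorProduct.lid ℝ ℝ (f (v ∘ finSumFinEquiv)))
    (MultilinearMap.domCoprod_alternization_eq α β)
  simp only [MultilinearMap.alternatization_apply] at h
  rw [← Equiv.sum_comp (finSumFinEquiv (m := 2) (n := 2)).symm.permCongr, map_sum] at h
  have h4 : TensorProduct.lid ℝ ℝ ((((Fintype.card (Fin 2)).factorial *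
      (Fintype.card (Fin 2)).factorial) • α.domCoprod β) (v ∘ finSumFinEquiv)) =
      4 * wedge α β v := by
    rw [AlternatingMap.smul_apply, map_nsmul, nsmul_eq_mul, Fintype.card_fin]
    refine congrArg₂ (· * ·) (by norm_num [Nat.factorial]) rfl
  rw [← h4, ← h]
  refine Finset.sum_congr rfl fun σ _ => ?_
  have hα : (fun i => v (finSumFinEquiv ((finSumFinEquiv (m := 2) (n := 2)).symm.permCongr σ
      (Sum.inl i)))) = ![v (σ 0), v (σ 1)] := by
    ext i; fin_cases i <;> simp [Equiv.permCongr_apply] <;> rfl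
  have hβ : (fun i => v (finSumFinEquiv ((finSumFinEquiv (m := 2) (n := 2)).symm.permCongr σ
      (Sum.inr i)))) = ![v (σ 2), v (σ 3)] := by
    ext i; fin_cases i <;> simp [Equiv.permCongr_apply] <;> rfl
  rw [Units.smul_def, map_zsmul, MultilinearMap.domDomCongr_apply, MultilinearMap.domCoprod_apply]
  simp only [Function.comp_apply, AlternatingMap.coe_multilinearMap, hα, hβ]
  simp

/-- The wedge product of two `2`-forms, evaluated by summing over the six shuffles. -/
theorem wedge_two_two_apply (α β : V [⋀^Fin 2]→ₗ[ℝ] ℝ) (a b c d : V) :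
    wedge α β ![a, b, c, d] =
      α ![a, b] * β ![c, d] - α ![a, c] * β ![b, d] + α ![a, d] * β ![b, c]
        + α ![b, c] * β ![a, d] - α ![b, d] * β ![a, c] + α ![c, d] * β ![a, b] := by
  have h := four_mul_wedge_two_two_apply α β ![a, b, c, d]
  have h2 (p : Fin 4) (e : Equiv.Perm (Fin 3)) :
      Equiv.Perm.decomposeFin.symm (p, e) 2 = Equiv.swap 0 p (e 1).succ :=
    Equiv.Perm.decomposeFin_symm_apply_succ e p 1
  have h3 (p : Fin 4) (e : Equiv.Perm (Fin 3)) :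
      Equiv.Perm.decomposeFin.symm (p, e) 3 = Equiv.swap 0 p (e 2).succ :=
    Equiv.Perm.decomposeFin_symm_apply_succ e p 2
  have h2' (p : Fin 3) (e : Equiv.Perm (Fin 2)) :
      Equiv.Perm.decomposeFin.symm (p, e) 2 = Equiv.swap 0 p (e 1).succ :=
    Equiv.Perm.decomposeFin_symm_apply_succ e p 1
  simp [Equiv.Perm.sum_fin_succ, Fin.sum_univ_succ, h2, h3, h2', Equiv.swap_apply_def] at h
  rw [α.apply_pair_swap a b, α.apply_pair_swap a c, α.apply_pair_swap a d, α.apply_pair_swap b c,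
    α.apply_pair_swap b d, α.apply_pair_swap c d, β.apply_pair_swap a b, β.apply_pair_swap a c,
    β.apply_pair_swap a d, β.apply_pair_swap b c, β.apply_pair_swap b d,
    β.apply_pair_swap c d] at h
  linarith

theorem wedge_two_two_compLinearMap (α β : V [⋀^Fin 2]→ₗ[ℝ] ℝ) (A : V →ₗ[ℝ] V) :
    (wedge α β).compLinearMap A = wedge (α.compLinearMap A) (β.compLinearMap A) := by
  ext v
  have hv : v = ![v 0, v 1, v 2, v 3] := by ext i; fin_cases i <;> rfl
  have hA (x y : V) : (fun i => A (![x, y] i)) = ![A x, A y] := by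
    ext i; fin_cases i <;> rfl
  have hA' (x y z w : V) : (fun i => A (![x, y, z, w] i)) = ![A x, A y, A z, A w] := by
    ext i; fin_cases i <;> rfl
  rw [hv, wedge_two_two_apply]
  simp only [AlternatingMap.compLinearMap_apply, hA]
  rw [← wedge_two_two_apply, ← hA']

/-- A `2`-form, viewed as a bilinear form. -/
noncomputable def AlternatingMap.toBilinForm_s3 (α : V [⋀^Fin 2]→ₗ[ℝ] ℝ) : V →ₗ[ℝ] V →ₗ[ℝ] ℝ :=
  have hadd (x y z : V) : α ![x + y, z] = α ![x, z] + α ![y, z] := α.map_vecCons_add ![z] x y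
  have hsmul (r : ℝ) (x z : V) : α ![r • x, z] = r • α ![x, z] := α.map_vecCons_smul ![z] r x
  LinearMap.mk₂ ℝ (fun v w => α ![v, w]) hadd hsmul
    (fun x y z => by
      rw [α.apply_pair_swap (y + z) x, α.apply_pair_swap y x, α.apply_pair_swap z x, hadd, neg_add])
    (fun r x y => by rw [α.apply_pair_swap (r • y) x, α.apply_pair_swap y x, hsmul, smul_neg])

theorem AlternatingMap.toBilinForm_apply (α : V [⋀^Fin 2]→ₗ[ℝ] ℝ) (v w : V) :
    α.toBilinForm_s3 v w = α ![v, w] := rfl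

theorem AlternatingMap.toBilinForm_swap (α : V [⋀^Fin 2]→ₗ[ℝ] ℝ) (v w : V) :
    α.toBilinForm_s3 w v = -α.toBilinForm_s3 v w :=
  α.apply_pair_swap v w

theorem AlternatingMap.toBilinForm_self (α : V [⋀^Fin 2]→ₗ[ℝ] ℝ) (v : V) :
    α.toBilinForm_s3 v v = 0 := by
  linarith [α.toBilinForm_swap v v]

theorem AlternatingMap.ext_basis_pair {ι : Type*} (e : Module.Basis ι ℝ V)
    {α β : V [⋀^Fin 2]→ₗ[ℝ] ℝ} (h : ∀ i j, α ![e i, e j] = β ![e i, e j]) : α = β := by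
  refine Module.Basis.ext_alternating e fun v _ => ?_
  have hv : (fun i => e (v i)) = ![e (v 0), e (v 1)] := by ext i; fin_cases i <;> rfl
  rw [hv, h]

variable [FiniteDimensional ℝ V]

/-- A symplectic form represents every `2`-form by an endomorphism. -/
theorem IsSymplecticForm.exists_endomorphism {ω : V [⋀^Fin 2]→ₗ[ℝ] ℝ} (hω : IsSymplecticForm ω)
    (φ : V [⋀^Fin 2]→ₗ[ℝ] ℝ) :
    ∃ R : V →ₗ[ℝ] V, ∀ v w, ω.toBilinForm_s3 (R v) w = φ.toBilinForm_s3 v w := by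
  have hinj : Function.Injective ω.toBilinForm_s3 := by
    rw [injective_iff_map_eq_zero]
    intro v hv
    by_contra hne
    obtain ⟨w, hw⟩ := hω v hne
    exact hw (LinearMap.congr_fun hv w)
  let E : V ≃ₗ[ℝ] Module.Dual ℝ V :=
    LinearMap.linearEquivOfInjective ω.toBilinForm_s3 hinj Subspace.dual_finrank_eq.symm
  refine ⟨E.symm.toLinearMap ∘ₗ φ.toBilinForm_s3, fun v w => ?_⟩
  exact LinearMap.congr_fun (E.apply_symm_apply (φ.toBilinForm_s3 v)) w

/-- In dimension greater than two, interior multiplication with `ω ∧ ω` is injective for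
symplectic `ω`. -/
theorem IsSymplecticForm.eq_zero_of_wedge_self_apply {ω : V [⋀^Fin 2]→ₗ[ℝ] ℝ}
    (hω : IsSymplecticForm ω) (hV : 2 < Module.finrank ℝ V) {u : V}
    (hu : ∀ x y z, wedge ω ω ![u, x, y, z] = 0) : u = 0 := by
  by_contra hne
  obtain ⟨x, hx⟩ := hω u hne
  have hker : LinearMap.ker ((ω.toBilinForm_s3 u).prod (ω.toBilinForm_s3 x)) ≠ ⊥ :=
    LinearMap.ker_ne_bot_of_finrank_lt (by simpa using hV)
  obtain ⟨y, hy, hy0⟩ := Submodule.exists_mem_ne_zero_of_ne_bot hker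
  obtain ⟨z, hz⟩ := hω y hy0
  replace hy : ω ![u, y] = 0 ∧ ω ![x, y] = 0 := Prod.mk_eq_zero.1 hy
  have h := hu x y z
  rw [wedge_two_two_apply, hy.1, hy.2] at h
  have : ω ![u, x] * ω ![y, z] = 0 := by linarith
  exact (mul_ne_zero hx hz) this

/-- If `ω ∧ φ = 0` and `φ ∧ φ = c ω ∧ ω`, then the endomorphism representing `φ` with respect to
`ω` squares to `-c`. -/
theorem IsSymplecticForm.endomorphism_sq {ω φ : V [⋀^Fin 2]→ₗ[ℝ] ℝ}
    (hω : IsSymplecticForm ω) (hV : 2 < Module.finrank ℝ V) (horth : wedge ω φ = 0) {c : ℝ}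
    (hc : wedge φ φ = c • wedge ω ω) {R : V →ₗ[ℝ] V}
    (hR : ∀ v w, ω.toBilinForm_s3 (R v) w = φ.toBilinForm_s3 v w) (v : V) :
    R (R v) = -(c • v) := by
  rw [← add_eq_zero_iff_eq_neg]
  refine hω.eq_zero_of_wedge_self_apply hV fun x y z => ?_
  have h1 : wedge ω φ ![R v, x, y, z] = 0 := by rw [horth]; rfl
  have h2 : wedge φ φ ![v, x, y, z] = c * wedge ω ω ![v, x, y, z] := by rw [hc]; rfl
  rw [wedge_two_two_apply] at h1
  simp only [wedge_two_two_apply, ← AlternatingMap.toBilinForm_apply] at h1 h2 ⊢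
  simp only [map_add, map_smul, LinearMap.add_apply, LinearMap.smul_apply, smul_eq_mul, hR]
  simp only [hR] at h1
  linarith

/-- The common normal form of pairs `(ω, φ)` with `ω` symplectic, `ω ∧ φ = 0` and
`φ ∧ φ = c ω ∧ ω` for some `c > 0`. -/
theorem IsSymplecticForm.exists_basis {ω φ : V [⋀^Fin 2]→ₗ[ℝ] ℝ}
    (hω : IsSymplecticForm ω) (hV : Module.finrank ℝ V = 4) (horth : wedge ω φ = 0) {c : ℝ}
    (hc0 : 0 < c) (hc : wedge φ φ = c • wedge ω ω) :
    ∃ e : Module.Basis (Fin 4) ℝ V, ∀ i j,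
      ω ![e i, e j] = !![0, 1, 0, 0; -1, 0, 0, 0; 0, 0, 0, -c; 0, 0, c, 0] i j ∧
      φ ![e i, e j] = !![0, 0, 0, -c; 0, 0, c, 0; 0, -c, 0, 0; c, 0, 0, 0] i j := by
  obtain ⟨R, hR⟩ := hω.exists_endomorphism φ
  have hRR := hω.endomorphism_sq (by omega) horth hc hR
  have hR' (v w : V) : ω.toBilinForm_s3 v (R w) = φ.toBilinForm_s3 v w := by
    rw [ω.toBilinForm_swap, hR, φ.toBilinForm_swap, neg_neg]
  have hφR (v w : V) : φ.toBilinForm_s3 (R v) w = -c * ω.toBilinForm_s3 v w := by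
    rw [← hR, hRR]; simp
  have hφR' (v w : V) : φ.toBilinForm_s3 v (R w) = -c * ω.toBilinForm_s3 v w := by
    rw [φ.toBilinForm_swap, hφR, ω.toBilinForm_swap]; simp
  have : Nontrivial V := Module.nontrivial_of_finrank_pos (R := ℝ) (by omega)
  obtain ⟨a, ha⟩ := exists_ne (0 : V)
  obtain ⟨b, hab, hab'⟩ : ∃ b, ω.toBilinForm_s3 a b = 1 ∧ φ.toBilinForm_s3 a b = 0 := by
    obtain ⟨w, hw⟩ := hω a ha
    rw [← AlternatingMap.toBilinForm_apply] at hw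
    set s := ω.toBilinForm_s3 a w
    set p := φ.toBilinForm_s3 a w
    have hd : c * s ^ 2 + p ^ 2 ≠ 0 := by positivity
    refine ⟨(c * s / (c * s ^ 2 + p ^ 2)) • w + (p / (c * s ^ 2 + p ^ 2)) • R w, ?_, ?_⟩
    · simp only [map_add, map_smul, smul_eq_mul, hR']
      field_simp
      ring
    · simp only [map_add, map_smul, smul_eq_mul, hφR']
      field_simp
      ring
  have hba := ω.toBilinForm_swap a b
  have hba' := φ.toBilinForm_swap a b
  rw [hab] at hba
  rw [hab', neg_zero] at hba'
  have hli : LinearIndependent ℝ ![a, b, R a, R b] := by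
    rw [Fintype.linearIndependent_iff]
    intro g hg
    rw [Fin.sum_univ_four] at hg
    have key (v : V) := congrArg (ω.toBilinForm_s3 v) hg
    have ka := key a
    have kb := key b
    have kc := key (R a)
    have kd := key (R b)
    simp [hR, hR', hφR', hab, hab', hba, hba', AlternatingMap.toBilinForm_self, hc0.ne']
      at ka kb kc kd
    intro i
    fin_cases i <;> simp [*]
  refine ⟨basisOfLinearIndependentOfCardEqFinrank hli (by simp [hV]), fun i j => ?_⟩
  rw [coe_basisOfLinearIndependentOfCardEqFinrank, ← AlternatingMap.toBilinForm_apply,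
    ← AlternatingMap.toBilinForm_apply]
  fin_cases i <;> fin_cases j <;>
    simp [hR, hR', hφR, hφR', hab, hab', hba, hba', AlternatingMap.toBilinForm_self]

end

/-- for a symplectic `ω` and `φ, φ′` orthogonal to `ω` with `(ω,φ)` and
`(ω,φ′)` elliptic, there is a linear isomorphism `A` of `V` with `A*ω = ω`, `A*φ = φ′`
iff `φ∧φ = φ′∧φ′`. -/
theorem stmt3 {V : Type*} [AddCommGroup V] [Module ℝ V]
    [FiniteDimensional ℝ V] (hV : Module.finrank ℝ V = 4)
    (o : Orientation ℝ V (Fin 4))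
    (ε : V [⋀^Fin 4]→ₗ[ℝ] ℝ) (hε : ε ≠ 0)
    (hor : rayOfNeZero ℝ ε hε = o)
    (B : (V [⋀^Fin 2]→ₗ[ℝ] ℝ) → (V [⋀^Fin 2]→ₗ[ℝ] ℝ) → ℝ)
    (hB : ∀ ω φ : V [⋀^Fin 2]→ₗ[ℝ] ℝ, wedge ω φ = B ω φ • ε)
    (ω φ φ' : V [⋀^Fin 2]→ₗ[ℝ] ℝ)
    (hsymp : IsSymplecticForm ω)
    (horth : wedge ω φ = 0) (horth' : wedge ω φ' = 0)
    (hell : B ω ω * B φ φ > (B ω φ) ^ 2)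
    (hell' : B ω ω * B φ' φ' > (B ω φ') ^ 2) :
    (∃ A : V ≃ₗ[ℝ] V,
        ω.compLinearMap (A : V →ₗ[ℝ] V) = ω ∧
        φ.compLinearMap (A : V →ₗ[ℝ] V) = φ') ↔
      wedge φ φ = wedge φ' φ' := by
  have hφ0 : B ω φ = 0 := by
    simpa [horth, hε] using (hB ω φ).symm
  rw [hφ0] at hell
  have hωω : B ω ω ≠ 0 := by
    rintro h
    simp [h] at hell
  constructor
  · rintro ⟨A, hAω, hAφ⟩
    have hA : ε.compLinearMap (A : V →ₗ[ℝ] V) = ε := by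
      have h := wedge_two_two_compLinearMap ω ω (A : V →ₗ[ℝ] V)
      rw [hAω, hB] at h
      exact smul_right_injective _ hωω h
    have h := wedge_two_two_compLinearMap φ φ (A : V →ₗ[ℝ] V)
    rw [hAφ] at h
    rw [← h, hB]
    exact congrArg (B φ φ • ·) hA.symm
  · intro h
    have hc0 : 0 < B φ φ / B ω ω := by
      have h1 : B φ φ / B ω ω = (B ω ω * B φ φ) / (B ω ω) ^ 2 := by field_simp
      rw [h1]
      exact div_pos (by simpa using hell) (by positivity)
    have hc : wedge φ φ = (B φ φ / B ω ω) • wedge ω ω := by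
      rw [hB φ φ, hB ω ω, smul_smul, div_mul_cancel₀ _ hωω]
    obtain ⟨e, he⟩ := hsymp.exists_basis hV horth hc0 hc
    obtain ⟨e', he'⟩ := hsymp.exists_basis hV horth' hc0 (h ▸ hc)
    have hA (i j : Fin 4) : (fun k => e'.equiv e (Equiv.refl _) (![e' i, e' j] k)) =
        ![e i, e j] := by
      ext k; fin_cases k <;> simp
    refine ⟨e'.equiv e (Equiv.refl _), AlternatingMap.ext_basis_pair e' fun i j => ?_,
      AlternatingMap.ext_basis_pair e' fun i j => ?_⟩
    · rw [(he' i j).1, ← (he i j).1, ← hA]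
      rfl
    · rw [(he' i j).2, ← (he i j).2, ← hA]
      rfl
end

section
/- Let w and f be the real 4×4 antisymmetric matrices of the 2-forms ω = e¹∧e³ − e²∧e⁴ and φ = e¹∧e⁴ + e²∧e³ with respect to the standard basis of ℝ⁴ (so ω = (1/2) w_{kl} e^k∧e^l and φ = (1/2) f_{kl} e^k∧e^l). Suppose a is a real invertible 4×4 matrix and x, y are real numbers, not both zero, such that aᵗwa = xw + yf and aᵗfa = −yw + xf. Then a commutes with the matrix wf, i.e. a(wf) = (wf)a. -/
open Matrix
/-- The antisymmetric matrix of the `2`-form `ω = e¹∧e³ − e²∧e⁴` on `ℝ⁴`,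
i.e. `ω = (1/2) w_{kl} e^k∧e^l`. -/
def wMat : Matrix (Fin 4) (Fin 4) ℝ :=
  !![0, 0, 1, 0; 0, 0, 0, -1; -1, 0, 0, 0; 0, 1, 0, 0]

/-- The antisymmetric matrix of the `2`-form `φ = e¹∧e⁴ + e²∧e³` on `ℝ⁴`,
i.e. `φ = (1/2) f_{kl} e^k∧e^l`. -/
def fMat : Matrix (Fin 4) (Fin 4) ℝ :=
  !![0, 0, 0, 1; 0, 0, 1, 0; 0, -1, 0, 0; -1, 0, 0, 0]

theorem wMat_mul_self : wMat * wMat = -1 := by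
  ext i j
  fin_cases i <;> fin_cases j <;> simp [wMat, Matrix.mul_apply, Fin.sum_univ_four]

theorem fMat_mul_self : fMat * fMat = -1 := by
  ext i j
  fin_cases i <;> fin_cases j <;> simp [fMat, Matrix.mul_apply, Fin.sum_univ_four]

theorem fMat_mul_wMat : fMat * wMat = -(wMat * fMat) := by
  ext i j
  fin_cases i <;> fin_cases j <;> simp [wMat, fMat, Matrix.mul_apply, Fin.sum_univ_four]

theorem wMat_mul_wMat_mul_fMat : wMat * (wMat * fMat) = -fMat := by
  rw [← mul_assoc, wMat_mul_self, neg_one_mul]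

theorem fMat_mul_wMat_mul_fMat : fMat * (wMat * fMat) = wMat := by
  rw [← mul_assoc, fMat_mul_wMat, neg_mul, mul_assoc, fMat_mul_self, mul_neg_one, neg_neg]

theorem isUnit_wMat : IsUnit wMat :=
  IsUnit.of_mul_eq_one (-wMat) (by rw [mul_neg, wMat_mul_self, neg_neg])

/-- if an invertible real `4×4` matrix `a` satisfies
`aᵗwa = xw + yf` and `aᵗfa = −yw + xf` for some reals `(x,y) ≠ (0,0)`,
then `a` commutes with `wf`. -/
theorem stmt5 (a : Matrix (Fin 4) (Fin 4) ℝ) (ha : IsUnit a)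
    (x y : ℝ) (hxy : ¬(x = 0 ∧ y = 0))
    (h1 : aᵀ * wMat * a = x • wMat + y • fMat)
    (h2 : aᵀ * fMat * a = (-y) • wMat + x • fMat) :
    a * (wMat * fMat) = (wMat * fMat) * a := by
  have hu : IsUnit (aᵀ * wMat) := ((Matrix.isUnit_transpose a).2 ha).mul isUnit_wMat
  apply hu.mul_left_cancel
  calc aᵀ * wMat * (a * (wMat * fMat))
      = (x • wMat + y • fMat) * (wMat * fMat) := by rw [← mul_assoc, h1]
    _ = -((-y) • wMat + x • fMat) := by
      rw [add_mul, smul_mul_assoc, smul_mul_assoc, wMat_mul_wMat_mul_fMat,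
        fMat_mul_wMat_mul_fMat]
      module
    _ = aᵀ * (wMat * (wMat * fMat)) * a := by
      rw [wMat_mul_wMat_mul_fMat, mul_neg, neg_mul, h2]
    _ = aᵀ * wMat * (wMat * fMat * a) := by simp only [mul_assoc]
end

section
/- Let V be an oriented 4-dimensional real vector space, J ∈ 𝒞⁺(V) a complex structure compatible with the orientation, and Λ_J ⊂ Λ²V* the oriented 2-plane spanned by the real and imaginary parts of a nonzero (2,0)-form for J (with Re(α), Im(α) positively oriented). If A ∈ GL⁺(V) satisfies A*(Λ_J) = Λ_J preserving the orientation of Λ_J, then A commutes with J. Consequently the stabiliser of J in GL⁺(V) equals the stabiliser of the oriented plane Λ_J. -/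
/-- The real part of a complex-valued alternating `2`-form. -/
noncomputable def reForm {V : Type*} [AddCommGroup V] [Module ℝ V]
    (α : V [⋀^Fin 2]→ₗ[ℝ] ℂ) : V [⋀^Fin 2]→ₗ[ℝ] ℝ :=
  Complex.reLm.compAlternatingMap α

/-- The imaginary part of a complex-valued alternating `2`-form. -/
noncomputable def imForm {V : Type*} [AddCommGroup V] [Module ℝ V]
    (α : V [⋀^Fin 2]→ₗ[ℝ] ℂ) : V [⋀^Fin 2]→ₗ[ℝ] ℝ :=
  Complex.imLm.compAlternatingMap α

/-- An alternating `2`-form regarded as a bilinear map. -/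
noncomputable def alternatingToBilin {V : Type*} [AddCommGroup V] [Module ℝ V]
    (α : V [⋀^Fin 2]→ₗ[ℝ] ℂ) : V →ₗ[ℝ] V →ₗ[ℝ] ℂ :=
  LinearMap.mk₂ ℝ (fun v w => α ![v, w])
    (fun v v' w => α.map_vecCons_add ![w] v v')
    (fun c v w => α.map_vecCons_smul ![w] c v)
    (fun v w w' => by
      have e (x : V) : Function.update ![v, 0] 1 x = ![v, x] := by
        ext i
        fin_cases i <;> rfl
      simpa only [e] using α.map_update_add ![v, 0] 1 w w')
    (fun c v w => by
      have e (x : V) : Function.update ![v, 0] 1 x = ![v, x] := by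
        ext i
        fin_cases i <;> rfl
      simpa only [e] using α.map_update_smul ![v, 0] 1 c w)

theorem alternatingToBilin_apply {V : Type*} [AddCommGroup V] [Module ℝ V]
    (α : V [⋀^Fin 2]→ₗ[ℝ] ℂ) (v w : V) : alternatingToBilin α v w = α ![v, w] := rfl

theorem isAlt_alternatingToBilin {V : Type*} [AddCommGroup V] [Module ℝ V]
    (α : V [⋀^Fin 2]→ₗ[ℝ] ℂ) : (alternatingToBilin α).IsAlt := fun v =>
  α.map_eq_zero_of_eq ![v, v] (i := 0) (j := 1) rfl (by decide)

/-- A bilinear form which is `J`-complex linear and alternating, i.e. a `(2,0)`-form. -/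
structure IsTwoZero {V : Type*} [AddCommGroup V] [Module ℝ V]
    (J : V →ₗ[ℝ] V) (B : V →ₗ[ℝ] V →ₗ[ℝ] ℂ) : Prop where
  alt : B.IsAlt
  left : ∀ v w, B (J v) w = Complex.I * B v w

namespace IsTwoZero

variable {V : Type*} [AddCommGroup V] [Module ℝ V] {J : V →ₗ[ℝ] V}
  {B B' : V →ₗ[ℝ] V →ₗ[ℝ] ℂ}

theorem swap (h : IsTwoZero J B) (v w : V) : B w v = -B v w := (h.alt.neg v w).symm

theorem right (h : IsTwoZero J B) (v w : V) : B v (J w) = Complex.I * B v w := by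
  rw [h.swap, h.left, h.swap v w]
  ring

theorem apply_left (h : IsTwoZero J B) (v w u : V) (x y z t : ℝ) :
    B (x • v + y • J v + z • w + t • J w) u =
      (x + y * Complex.I) * B v u + (z + t * Complex.I) * B w u := by
  simp only [map_add, map_smul, LinearMap.add_apply, LinearMap.smul_apply, h.left,
    Complex.real_smul]
  ring

theorem apply_right (h : IsTwoZero J B) (v w u : V) (x y z t : ℝ) :
    B u (x • v + y • J v + z • w + t • J w) =
      (x + y * Complex.I) * B u v + (z + t * Complex.I) * B u w := by
  rw [h.swap _ u, h.apply_left, h.swap u v, h.swap u w]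
  ring

theorem coeff_eq_zero {x y : ℝ} (h : (x + y * Complex.I : ℂ) = 0) : x = 0 ∧ y = 0 := by
  simpa [Complex.ext_iff] using h

theorem exists_coords [FiniteDimensional ℝ V] (h : IsTwoZero J B) (hV : Module.finrank ℝ V = 4)
    {v w : V} (hvw : B v w ≠ 0) (u : V) :
    ∃ x y z t : ℝ, u = x • v + y • J v + z • w + t • J w := by
  have hli : LinearIndependent ℝ ![v, J v, w, J w] := by
    rw [Fintype.linearIndependent_iff]
    intro g hg
    simp only [Fin.sum_univ_four] at hg
    change g 0 • v + g 1 • J v + g 2 • w + g 3 • J w = 0 at hg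
    have h1 := h.apply_left v w w (g 0) (g 1) (g 2) (g 3)
    have h2 := h.apply_right v w v (g 0) (g 1) (g 2) (g 3)
    rw [hg] at h1 h2
    simp only [map_zero, LinearMap.zero_apply, h.alt v, h.alt w, mul_zero, add_zero,
      zero_add] at h1 h2
    have h3 := coeff_eq_zero ((mul_eq_zero.1 h1.symm).resolve_right hvw)
    have h4 := coeff_eq_zero ((mul_eq_zero.1 h2.symm).resolve_right hvw)
    intro i
    fin_cases i
    exacts [h3.1, h3.2, h4.1, h4.2]
  have hspan := hli.span_eq_top_of_card_eq_finrank' (by simp [hV])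
  have hu : u ∈ Submodule.span ℝ (Set.range ![v, J v, w, J w]) := hspan ▸ Submodule.mem_top
  obtain ⟨c, rfl⟩ := (Submodule.mem_span_range_iff_exists_fun ℝ).1 hu
  exact ⟨c 0, c 1, c 2, c 3, by simp [Fin.sum_univ_four]⟩

theorem exists_apply_ne_zero [FiniteDimensional ℝ V] (h : IsTwoZero J B) (hV : Module.finrank ℝ V = 4)
    (hB : B ≠ 0) {x : V} (hx : x ≠ 0) : ∃ w, B x w ≠ 0 := by
  obtain ⟨v, w, hvw⟩ : ∃ v w, B v w ≠ 0 := by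
    by_contra! hc
    exact hB (LinearMap.ext₂ hc)
  by_contra! hc
  obtain ⟨a, b, c, d, rfl⟩ := h.exists_coords hV hvw x
  have h1 := hc w
  have h2 := hc v
  rw [h.apply_left] at h1 h2
  rw [h.swap v w] at h2
  simp only [h.alt v, h.alt w, mul_zero, add_zero, zero_add] at h1 h2
  obtain ⟨rfl, rfl⟩ := coeff_eq_zero ((mul_eq_zero.1 h1).resolve_right hvw)
  obtain ⟨rfl, rfl⟩ := coeff_eq_zero ((mul_eq_zero.1 h2).resolve_right (neg_ne_zero.2 hvw))
  simp at hx

theorem surjective_apply [FiniteDimensional ℝ V] (h : IsTwoZero J B) (hV : Module.finrank ℝ V = 4)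
    (hB : B ≠ 0) {x : V} (hx : x ≠ 0) (z : ℂ) : ∃ w, B x w = z := by
  obtain ⟨w, hw⟩ := h.exists_apply_ne_zero hV hB hx
  refine ⟨(z / B x w).re • w + (z / B x w).im • J w, ?_⟩
  have h1 := h.apply_right w 0 x (z / B x w).re (z / B x w).im 0 0
  simp only [zero_smul, add_zero, map_zero, mul_zero, Complex.re_add_im] at h1
  rw [h1, div_mul_cancel₀ _ hw]

theorem exists_eq_of_apply_eq_zero [FiniteDimensional ℝ V] (h : IsTwoZero J B) (hV : Module.finrank ℝ V = 4)
    (hB : B ≠ 0) {x y : V} (hx : x ≠ 0) (hxy : B x y = 0) :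
    ∃ s t : ℝ, y = s • x + t • J x := by
  obtain ⟨w, hw⟩ := h.exists_apply_ne_zero hV hB hx
  obtain ⟨a, b, c, d, rfl⟩ := h.exists_coords hV hw y
  rw [h.apply_right, h.alt x, mul_zero, zero_add] at hxy
  obtain ⟨rfl, rfl⟩ := coeff_eq_zero ((mul_eq_zero.1 hxy).resolve_right hw)
  exact ⟨a, b, by simp⟩

/-- On a real `4`-dimensional space the `(2,0)`-forms make up a complex line. -/
theorem exists_eq_mul [FiniteDimensional ℝ V] (h : IsTwoZero J B) (h' : IsTwoZero J B')
    (hV : Module.finrank ℝ V = 4) (hB : B ≠ 0) : ∃ p : ℂ, ∀ x y, B' x y = p * B x y := by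
  obtain ⟨v, w, hvw⟩ : ∃ v w, B v w ≠ 0 := by
    by_contra! hc
    exact hB (LinearMap.ext₂ hc)
  refine ⟨B' v w / B v w, fun x y => ?_⟩
  obtain ⟨a, b, c, d, rfl⟩ := h.exists_coords hV hvw x
  obtain ⟨a', b', c', d', rfl⟩ := h.exists_coords hV hvw y
  simp only [h.apply_left, h.apply_right, h'.apply_left, h'.apply_right, h.alt v, h.alt w,
    h'.alt v, h'.alt w, h.swap v w, h'.swap v w]
  field_simp
  ring

/-- If `A` pulls back `B` to a real-linear function of `B` with positive determinant, then
`A` commutes with `J`. -/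
theorem comm_of_pullback [FiniteDimensional ℝ V] (h : IsTwoZero J B) (hV : Module.finrank ℝ V = 4) (hB : B ≠ 0)
    (A : V ≃ₗ[ℝ] V) {a b c d : ℝ} (hdet : 0 < a * d - b * c)
    (hre : ∀ v w, (B (A v) (A w)).re = a * (B v w).re + b * (B v w).im)
    (him : ∀ v w, (B (A v) (A w)).im = c * (B v w).re + d * (B v w).im) (x : V) :
    A (J x) = J (A x) := by
  rcases eq_or_ne x 0 with rfl | hx
  · simp
  obtain ⟨y, hy⟩ := A.surjective (J (A x))
  have hAxy : B (A x) (A y) = 0 := by rw [hy, h.right, h.alt, mul_zero]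
  have hxy : B x y = 0 := by
    have h1 := hre x y
    have h2 := him x y
    simp only [hAxy, Complex.zero_re, Complex.zero_im] at h1 h2
    apply Complex.ext
    · refine (mul_eq_zero.1 (?_ : (a * d - b * c) * (B x y).re = 0)).resolve_left hdet.ne'
      linear_combination b * h2 - d * h1
    · refine (mul_eq_zero.1 (?_ : (a * d - b * c) * (B x y).im = 0)).resolve_left hdet.ne'
      linear_combination c * h1 - a * h2
  obtain ⟨s, t, rfl⟩ := h.exists_eq_of_apply_eq_zero hV hB hx hxy
  have key (w : V) : B (s • x + t • J x) w = (s + t * Complex.I) * B x w := by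
    simpa using h.apply_left x 0 w s t 0 0
  have hI (w : V) : B (A (s • x + t • J x)) (A w) = Complex.I * B (A x) (A w) := by
    rw [hy, h.left]
  obtain ⟨u, hu⟩ := h.surjective_apply hV hB hx 1
  obtain ⟨v, hv⟩ := h.surjective_apply hV hB hx Complex.I
  have e1 := congrArg Complex.re (hI u)
  have e2 := congrArg Complex.im (hI u)
  have e3 := congrArg Complex.re (hI v)
  have e4 := congrArg Complex.im (hI v)
  simp only [Complex.I_mul_re, Complex.I_mul_im] at e1 e2 e3 e4
  simp only [hre, him, key, hu, hv] at e1 e2 e3 e4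
  simp at e1 e2 e3 e4
  have hs : s = 0 := by
    refine (mul_eq_zero.1 (?_ : (a * d - b * c) * s = 0)).resolve_left hdet.ne'
    linear_combination (d * e1 - b * e2 - c * e3 + a * e4) / 2
  subst hs
  have ht : t = 1 := by
    simp only [mul_zero, zero_add, add_zero] at e1 e2 e3 e4
    have hsq : (a * d - b * c) * ((t - 1) * (t + 1)) = 0 := by
      linear_combination a * t * e2 - a * e3 - c * t * e1 - c * e4
    have hpos : 0 < t * (b ^ 2 + d ^ 2) := by
      linear_combination hdet - d * e2 - b * e1
    have htpos : 0 < t := pos_of_mul_pos_left hpos (by positivity)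
    have h1 := (mul_eq_zero.1 hsq).resolve_left hdet.ne'
    linarith [(mul_eq_zero.1 h1).resolve_right (by linarith)]
  rw [← hy, ht]
  simp

end IsTwoZero

/-- let `J` be an orientation-compatible complex structure on an oriented
`4`-dimensional real vector space `V` and `Λ_J` the oriented `2`-plane in `Λ²V*` spanned
by the real and imaginary parts of a nonzero `(2,0)`-form `α` for `J`.  An
orientation-preserving automorphism `A` of `V` pulls back `Λ_J` to itself preserving its
orientation if and only if `A` commutes with `J`; in particular the stabiliser of `J` in
`GL⁺(V)` equals the stabiliser of the oriented plane `Λ_J`. -/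
theorem stmt6 {V : Type*} [AddCommGroup V] [Module ℝ V]
    [FiniteDimensional ℝ V] (hV : Module.finrank ℝ V = 4)
    (o : Orientation ℝ V (Fin 4))
    (ε : V [⋀^Fin 4]→ₗ[ℝ] ℝ) (hε : ε ≠ 0)
    (hor : rayOfNeZero ℝ ε hε = o)
    (J : V →ₗ[ℝ] V) (hJ : J ∘ₗ J = -LinearMap.id)
    (hJo : ∀ v w : V, 0 ≤ ε ![v, J v, w, J w])
    (α : V [⋀^Fin 2]→ₗ[ℝ] ℂ) (hα : α ≠ 0)
    (h20 : ∀ v w : V, α ![J v, w] = Complex.I * α ![v, w])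
    (A : V ≃ₗ[ℝ] V) (hA : 0 < LinearMap.det (A : V →ₗ[ℝ] V)) :
    (∃ a b c d : ℝ, a * d - b * c > 0 ∧
        (reForm α).compLinearMap (A : V →ₗ[ℝ] V) = a • reForm α + b • imForm α ∧
        (imForm α).compLinearMap (A : V →ₗ[ℝ] V) = c • reForm α + d • imForm α) ↔
      (A : V →ₗ[ℝ] V) ∘ₗ J = J ∘ₗ (A : V →ₗ[ℝ] V) := by
  set B := alternatingToBilin α with hBdef
  have h : IsTwoZero J B := ⟨isAlt_alternatingToBilin α, h20⟩
  have hcons (f : V → V) (u : Fin 2 → V) : (fun i => f (u i)) = ![f (u 0), f (u 1)] := by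
    ext i
    fin_cases i <;> rfl
  have hB : B ≠ 0 := by
    intro h0
    refine hα (AlternatingMap.ext fun u => ?_)
    have h1 : B (u 0) (u 1) = 0 := by rw [h0]; rfl
    rwa [hBdef, alternatingToBilin_apply, ← hcons (fun v => v) u] at h1
  constructor
  · rintro ⟨a, b, c, d, hdet, hre, him⟩
    refine LinearMap.ext fun x => h.comm_of_pullback hV hB A hdet (fun v w => ?_)
      (fun v w => ?_) x
    · have h1 := DFunLike.congr_fun hre ![v, w]
      simp only [reForm, imForm, AlternatingMap.compLinearMap_apply,
        LinearMap.compAlternatingMap_apply, AlternatingMap.add_apply,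
        AlternatingMap.smul_apply, hcons, smul_eq_mul] at h1
      exact h1
    · have h1 := DFunLike.congr_fun him ![v, w]
      simp only [reForm, imForm, AlternatingMap.compLinearMap_apply,
        LinearMap.compAlternatingMap_apply, AlternatingMap.add_apply,
        AlternatingMap.smul_apply, hcons, smul_eq_mul] at h1
      exact h1
  · intro hAJ
    have hcomm (v : V) : A (J v) = J (A v) := LinearMap.congr_fun hAJ v
    have h' : IsTwoZero J (B.compl₁₂ (A : V →ₗ[ℝ] V) (A : V →ₗ[ℝ] V)) := by
      refine ⟨fun v => h.alt (A v), fun v w => ?_⟩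
      simp [hcomm, h.left]
    obtain ⟨p, hp⟩ := h.exists_eq_mul h' hV hB
    have hp0 : p ≠ 0 := by
      rintro rfl
      refine hB (LinearMap.ext₂ fun v w => ?_)
      simpa using hp (A.symm v) (A.symm w)
    have hpα (u : Fin 2 → V) : α (fun i => A (u i)) = p * α u := by
      have h1 : α ![A (u 0), A (u 1)] = p * α ![u 0, u 1] := hp (u 0) (u 1)
      rwa [← hcons (fun v => A v) u, ← hcons (fun v => v) u] at h1
    have hnorm := Complex.normSq_pos.2 hp0
    rw [Complex.normSq_apply] at hnorm
    refine ⟨p.re, -p.im, p.im, p.re, by linarith, AlternatingMap.ext fun u => ?_,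
      AlternatingMap.ext fun u => ?_⟩
    · have h1 := congrArg Complex.re (hpα u)
      rw [Complex.mul_re] at h1
      change (α (fun i => A (u i))).re = p.re * (α u).re + -p.im * (α u).im
      linarith
    · have h1 := congrArg Complex.im (hpα u)
      rw [Complex.mul_im] at h1
      change (α (fun i => A (u i))).im = p.im * (α u).re + p.re * (α u).im
      linarith
end

section
/- Let V be an oriented 4-dimensional real vector space. The group GL⁺(V) of orientation-preserving linear automorphisms of V acts transitively (via pullback) on the space G₂⁺(Λ²V*, ∧₊) of oriented 2-planes in Λ²V* on which the wedge product restricts to be positive definite; equivalently, every such oriented 2-plane admits a positively oriented basis (ω,φ) with ω∧φ = 0, ω∧ω = φ∧φ > 0, and any two such planes with such bases are related by pullback along an element of GL⁺(V). -/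
open scoped TensorProduct

/-- Two bases `(ω,φ)` and `(ω',φ')` of planes in `Λ²V*` span the same plane with the
same orientation. -/
def SameOrientedPlane {V : Type*} [AddCommGroup V] [Module ℝ V]
    (ω φ ω' φ' : V [⋀^Fin 2]→ₗ[ℝ] ℝ) : Prop :=
  ∃ a b c d : ℝ, a * d - b * c > 0 ∧ ω' = a • ω + b • φ ∧ φ' = c • ω + d • φ

theorem sum_perm_succ {n : ℕ} (f : Equiv.Perm (Fin (n + 1)) → ℝ) :
    ∑ σ, f σ = ∑ p, ∑ e, f (Equiv.Perm.decomposeFin.symm (p, e)) := by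
  rw [← Equiv.Perm.decomposeFin.symm.sum_comp, Fintype.sum_prod_type]

theorem sum_sign_mul_perm_fin_four (g : Fin 4 → Fin 4 → Fin 4 → Fin 4 → ℝ) :
    ∑ σ : Equiv.Perm (Fin 4), (Equiv.Perm.sign σ : ℝ) * g (σ 0) (σ 1) (σ 2) (σ 3) =
      g 0 1 2 3 - g 0 1 3 2 - g 0 2 1 3 + g 0 2 3 1 - g 0 3 2 1 + g 0 3 1 2
      - g 1 0 2 3 + g 1 0 3 2 + g 1 2 0 3 - g 1 2 3 0 + g 1 3 2 0 - g 1 3 0 2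
      - g 2 1 0 3 + g 2 1 3 0 + g 2 0 1 3 - g 2 0 3 1 + g 2 3 0 1 - g 2 3 1 0
      - g 3 1 2 0 + g 3 1 0 2 + g 3 2 1 0 - g 3 2 0 1 + g 3 0 2 1 - g 3 0 1 2 := by
  simp only [sum_perm_succ, Fin.sum_univ_four, Fin.sum_univ_three, Fin.sum_univ_two,
    Finset.univ_unique, Finset.sum_singleton, Equiv.Perm.decomposeFin.symm_sign,
    Equiv.Perm.decomposeFin_symm_apply_zero, Equiv.Perm.decomposeFin_symm_apply_one]
  simp only [show (2 : Fin 4) = Fin.succ 1 from rfl, show (3 : Fin 4) = Fin.succ 2 from rfl,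
    show (2 : Fin 3) = Fin.succ 1 from rfl, Equiv.Perm.decomposeFin_symm_apply_zero,
    Equiv.Perm.decomposeFin_symm_apply_one, Equiv.Perm.decomposeFin_symm_apply_succ]
  simp [Equiv.swap_apply_def, -Fin.reduceSucc]
  simp [show (Fin.succ 2 : Fin 4) = 3 from rfl]
  ring

theorem AlternatingMap.map_pair_swap {V : Type*} [AddCommGroup V] [Module ℝ V]
    (ω : V [⋀^Fin 2]→ₗ[ℝ] ℝ) (x y : V) : ω ![y, x] = -ω ![x, y] := by
  rw [← ω.map_swap ![x, y] (show (0 : Fin 2) ≠ 1 by decide)]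
  congr 1
  ext i
  fin_cases i <;> simp

theorem wedge_two_two_apply_s8 {V : Type*} [AddCommGroup V] [Module ℝ V]
    (ω φ : V [⋀^Fin 2]→ₗ[ℝ] ℝ) (w : Fin 4 → V) :
    wedge ω φ w = ω ![w 0, w 1] * φ ![w 2, w 3] - ω ![w 0, w 2] * φ ![w 1, w 3]
      + ω ![w 0, w 3] * φ ![w 1, w 2] + ω ![w 1, w 2] * φ ![w 0, w 3]
      - ω ![w 1, w 3] * φ ![w 0, w 2] + ω ![w 2, w 3] * φ ![w 0, w 1] := by
  have key := congrArg (fun F => (TensorProduct.lid ℝ ℝ) (F (fun i => w (finSumFinEquiv i))))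
    (MultilinearMap.domCoprod_alternization_eq ω φ)
  have h4 : ∑ σ : Equiv.Perm (Fin 4), (Equiv.Perm.sign σ : ℝ) *
      (ω ![w (σ 0), w (σ 1)] * φ ![w (σ 2), w (σ 3)]) = 4 * wedge ω φ w := by
    have hR : (TensorProduct.lid ℝ ℝ) ((((Fintype.card (Fin 2)).factorial *
        (Fintype.card (Fin 2)).factorial) • ω.domCoprod φ)
        (fun i => w (finSumFinEquiv i))) = 4 * wedge ω φ w := by
      rw [AlternatingMap.smul_apply, map_nsmul]
      rw [show wedge ω φ w = (TensorProduct.lid ℝ ℝ)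
        (ω.domCoprod φ fun i => w (finSumFinEquiv i)) from rfl, nsmul_eq_mul]
      congr 1
    rw [← hR, ← key, MultilinearMap.alternatization_apply, map_sum]
    symm
    refine Fintype.sum_equiv (Equiv.permCongr finSumFinEquiv) _ _ fun σ => ?_
    have e1 : ∀ (ω : V [⋀^Fin 2]→ₗ[ℝ] ℝ) (f : Fin 2 → V), ω f = ω ![f 0, f 1] := by
      intro ω f
      congr 1
      ext i
      fin_cases i <;> rfl
    have e2 : (Equiv.Perm.sign ((Equiv.permCongr finSumFinEquiv) σ)) = Equiv.Perm.sign σ :=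
      Equiv.Perm.sign_permCongr _ _
    rw [e2]
    rcases Int.units_eq_one_or (Equiv.Perm.sign σ) with h | h <;>
    · simp [h, e1 ω (fun i => _), e1 φ (fun i => _), Equiv.permCongr_apply]
      rfl
  have hs := sum_sign_mul_perm_fin_four fun i j k l => ω ![w i, w j] * φ ![w k, w l]
  rw [h4] at hs
  simp only [ω.map_pair_swap (w 0) (w 1), ω.map_pair_swap (w 0) (w 2),
    ω.map_pair_swap (w 0) (w 3), ω.map_pair_swap (w 1) (w 2), ω.map_pair_swap (w 1) (w 3),
    ω.map_pair_swap (w 2) (w 3), φ.map_pair_swap (w 0) (w 1), φ.map_pair_swap (w 0) (w 2),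
    φ.map_pair_swap (w 0) (w 3), φ.map_pair_swap (w 1) (w 2), φ.map_pair_swap (w 1) (w 3),
    φ.map_pair_swap (w 2) (w 3)] at hs
  linarith

theorem AlternatingMap.eq_zero_of_forall_map_eq_zero {ι K V : Type*} [Fintype ι] [DecidableEq ι]
    [Field K] [AddCommGroup V] [Module K V] (b : Module.Basis ι K V) {η : V [⋀^ι]→ₗ[K] K}
    (hη : η ≠ 0) {x : V} (hx : ∀ (w : ι → V) (i : ι), w i = x → η w = 0) : x = 0 := by
  have hb : η b ≠ 0 := (η.map_basis_ne_zero_iff b).2 hη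
  refine b.ext_elem fun i => ?_
  have h := hx (Function.update b i x) i (by simp)
  have hcoord : b.repr x i * η b = η (Function.update b i x) := by
    conv_rhs => rw [← b.sum_repr x]
    rw [AlternatingMap.map_update_sum, Finset.sum_eq_single i]
    · simp
    · intro j _ hj
      rw [AlternatingMap.map_update_smul, AlternatingMap.map_update_self _ _ hj.symm, smul_zero]
    · simp
  rw [h] at hcoord
  simpa [hb] using hcoord

theorem AlternatingMap.map_det_mul {ι K V : Type*} [Fintype ι] [DecidableEq ι]
    [Field K] [AddCommGroup V] [Module K V] (b : Module.Basis ι K V) (η : V [⋀^ι]→ₗ[K] K)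
    (A : V →ₗ[K] V) : η (fun i => A (b i)) = LinearMap.det A * η b := by
  rw [η.eq_smul_basis_det b]
  have := b.det_comp A b
  simp only [Function.comp_def] at this
  simp only [AlternatingMap.smul_apply, smul_eq_mul, this]
  ring

theorem exists_conformal_coordinates {V : Type*} [AddCommGroup V] [Module ℝ V]
    [FiniteDimensional ℝ V] (hV : Module.finrank ℝ V = 4) {ω φ : V [⋀^Fin 2]→ₗ[ℝ] ℝ}
    (h₀ : wedge ω φ = 0) (h₁ : wedge ω ω = wedge φ φ) (h₂ : wedge ω ω ≠ 0) :
    ∃ e : V ≃ₗ[ℝ] (Fin 4 → ℝ), ∀ x y,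
      ω ![x, y] = e x 0 * e y 2 - e x 2 * e y 0 - (e x 1 * e y 3 - e x 3 * e y 1) ∧
      φ ![x, y] = e x 0 * e y 3 - e x 3 * e y 0 + (e x 1 * e y 2 - e x 2 * e y 1) := by
  have hω : ∃ u v, ω ![u, v] ≠ 0 := by
    by_contra! h
    refine h₂ (AlternatingMap.ext fun w => ?_)
    rw [wedge_two_two_apply_s8]
    simp [h]
  obtain ⟨u, v, huv⟩ := hω
  set p := ω ![u, v] with hp
  set q := φ ![u, v] with hq
  have hN : p ^ 2 + q ^ 2 ≠ 0 := by positivity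
  have hlin (ψ : V [⋀^Fin 2]→ₗ[ℝ] ℝ) (u : V) : ∃ f : V →ₗ[ℝ] ℝ, ∀ x, f x = ψ ![u, x] := by
    refine ⟨ψ.toMultilinearMap.toLinearMap ![u, 0] 1, fun x => ?_⟩
    change ψ _ = _
    congr 1
    ext i
    fin_cases i <;> simp
  obtain ⟨a, ha⟩ := hlin ω u
  obtain ⟨b, hb⟩ := hlin φ u
  obtain ⟨c, hc⟩ := hlin ω v
  obtain ⟨d, hd⟩ := hlin φ v
  let α : V →ₗ[ℝ] (Fin 4 → ℝ) := LinearMap.pi ![a, b,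
    (p ^ 2 + q ^ 2)⁻¹ • (p • c + q • d), (p ^ 2 + q ^ 2)⁻¹ • (p • d - q • c)]
  have α0 (x) : α x 0 = ω ![u, x] := by simp [α, ha]
  have α1 (x) : α x 1 = φ ![u, x] := by simp [α, hb]
  have α2 (x) : α x 2 = (p ^ 2 + q ^ 2)⁻¹ * (p * ω ![v, x] + q * φ ![v, x]) := by
    simp [α, hc, hd, mul_add]
  have α3 (x) : α x 3 = (p ^ 2 + q ^ 2)⁻¹ * (p * φ ![v, x] - q * ω ![v, x]) := by
    simp [α, hc, hd]
  have hα (x y) :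
      ω ![x, y] = α x 0 * α y 2 - α x 2 * α y 0 - (α x 1 * α y 3 - α x 3 * α y 1) ∧
      φ ![x, y] = α x 0 * α y 3 - α x 3 * α y 0 + (α x 1 * α y 2 - α x 2 * α y 1) := by
    have hre := DFunLike.congr_fun h₁ ![u, v, x, y]
    have him := DFunLike.congr_fun h₀ ![u, v, x, y]
    rw [wedge_two_two_apply_s8, wedge_two_two_apply_s8] at hre
    rw [wedge_two_two_apply_s8] at him
    simp [← hp, ← hq] at hre him
    rw [α0, α0, α1, α1, α2, α2, α3, α3]
    constructor
    · field_simp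
      linear_combination p / 2 * hre + q * him
    · field_simp
      linear_combination p * him - q / 2 * hre
  have hinj : Function.Injective α := by
    rw [← LinearMap.ker_eq_bot, LinearMap.ker_eq_bot']
    intro x hx
    have hl (y) : ω ![x, y] = 0 := by simp [(hα x y).1, hx]
    have hr (y) : ω ![y, x] = 0 := by rw [ω.map_pair_swap, hl, neg_zero]
    refine AlternatingMap.eq_zero_of_forall_map_eq_zero
      (Module.finBasisOfFinrankEq ℝ V hV) h₂ fun w i hi => ?_
    rw [wedge_two_two_apply_s8]
    fin_cases i <;> simp at hi <;> simp [hi, hl, hr]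
  exact ⟨LinearEquiv.ofInjectiveOfFinrankEq α hinj (by simp [hV]), hα⟩

/-- `GL⁺(V)` acts transitively via pullback on the space
`G₂⁺(Λ²V*, ∧₊)` of oriented `2`-planes in `Λ²V*` on which the wedge product is
positive definite.  Equivalently: (i) every such oriented plane (given by a
positively oriented basis on which the wedge pairing is positive definite) admits a
positively oriented basis `(ω,φ)` with `ω∧φ = 0` and `ω∧ω = φ∧φ > 0`, and (ii) any
two planes with such bases are related by pullback along an orientation-preserving
automorphism of `V`. -/
theorem stmt8 {V : Type*} [AddCommGroup V] [Module ℝ V]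
    [FiniteDimensional ℝ V] (hV : Module.finrank ℝ V = 4)
    (o : Orientation ℝ V (Fin 4))
    (ε : V [⋀^Fin 4]→ₗ[ℝ] ℝ) (hε : ε ≠ 0)
    (hor : rayOfNeZero ℝ ε hε = o)
    (B : (V [⋀^Fin 2]→ₗ[ℝ] ℝ) → (V [⋀^Fin 2]→ₗ[ℝ] ℝ) → ℝ)
    (hB : ∀ ω φ : V [⋀^Fin 2]→ₗ[ℝ] ℝ, wedge ω φ = B ω φ • ε) :
    -- (i) every oriented plane on which the wedge pairing is positive definite has a
    -- positively oriented conformal basis: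
    (∀ ω φ : V [⋀^Fin 2]→ₗ[ℝ] ℝ,
      0 < B ω ω → (B ω φ) ^ 2 < B ω ω * B φ φ →
      ∃ ω' φ' : V [⋀^Fin 2]→ₗ[ℝ] ℝ, SameOrientedPlane ω φ ω' φ' ∧
        wedge ω' φ' = 0 ∧ B ω' ω' = B φ' φ' ∧ 0 < B ω' ω') ∧
    -- (ii) any two such planes are related by pullback along an element of `GL⁺(V)`:
    (∀ ω φ ω' φ' : V [⋀^Fin 2]→ₗ[ℝ] ℝ,
      wedge ω φ = 0 → B ω ω = B φ φ → 0 < B ω ω →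
      wedge ω' φ' = 0 → B ω' ω' = B φ' φ' → 0 < B ω' ω' →
      ∃ A : V ≃ₗ[ℝ] V, 0 < LinearMap.det (A : V →ₗ[ℝ] V) ∧
        SameOrientedPlane ω φ
          (ω'.compLinearMap (A : V →ₗ[ℝ] V)) (φ'.compLinearMap (A : V →ₗ[ℝ] V))) := by
  let b := Module.finBasisOfFinrankEq ℝ V hV
  have hb : ε b ≠ 0 := (ε.map_basis_ne_zero_iff b).2 hε
  have hBb (ω φ : V [⋀^Fin 2]→ₗ[ℝ] ℝ) : B ω φ = wedge ω φ b / ε b := by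
    rw [hB, AlternatingMap.smul_apply, smul_eq_mul, mul_div_cancel_right₀ _ hb]
  constructor
  · intro ω φ hω hdisc
    have hexp (r t : ℝ) : B ω (r • ω + t • φ) = r * B ω ω + t * B ω φ ∧
        B (r • ω + t • φ) (r • ω + t • φ) =
          r ^ 2 * B ω ω + 2 * (r * t) * B ω φ + t ^ 2 * B φ φ := by
      simp only [hBb, wedge_two_two_apply_s8, AlternatingMap.add_apply, AlternatingMap.smul_apply,
        smul_eq_mul]
      constructor <;> ring
    have hD : 0 < B ω ω * B φ φ - B ω φ ^ 2 := sub_pos.2 hdisc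
    set s := √(B ω ω * B φ φ - B ω φ ^ 2) with hs
    have hs0 : 0 < s := Real.sqrt_pos.2 hD
    have hs2 : s ^ 2 = B ω ω * B φ φ - B ω φ ^ 2 := Real.sq_sqrt hD.le
    refine ⟨ω, (-(B ω φ / s)) • ω + (B ω ω / s) • φ,
      ⟨1, 0, -(B ω φ / s), B ω ω / s, ?_, by simp, rfl⟩, ?_, ?_, hω⟩
    · have : 0 < B ω ω / s := by positivity
      simpa using this
    · rw [hB, (hexp _ _).1]
      convert zero_smul ℝ ε using 2
      ring
    · rw [(hexp _ _).2]
      field_simp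
      linear_combination hs2
  · intro ω φ ω' φ' h₀ h₁ h₂ h₀' h₁' h₂'
    obtain ⟨e, he⟩ := exists_conformal_coordinates hV h₀ (by rw [hB, hB φ, h₁])
      (by rw [hB]; exact smul_ne_zero h₂.ne' hε)
    obtain ⟨e', he'⟩ := exists_conformal_coordinates hV h₀' (by rw [hB, hB φ', h₁'])
      (by rw [hB]; exact smul_ne_zero h₂'.ne' hε)
    let A : V ≃ₗ[ℝ] V := e.trans e'.symm
    have hA (x : V) : e' (A x) = e x := by simp [A]
    have hωA (x y : V) : ω' ![A x, A y] = ω ![x, y] := by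
      rw [(he' _ _).1, (he _ _).1, hA, hA]
    have hφA (x y : V) : φ' ![A x, A y] = φ ![x, y] := by
      rw [(he' _ _).2, (he _ _).2, hA, hA]
    have hpull {ψ ψ' : V [⋀^Fin 2]→ₗ[ℝ] ℝ} (h : ∀ x y, ψ' ![A x, A y] = ψ ![x, y]) :
        ψ'.compLinearMap (A : V →ₗ[ℝ] V) = ψ := by
      ext w
      have := h (w 0) (w 1)
      convert this using 1
      · rw [AlternatingMap.compLinearMap_apply]
        congr 1
        ext i
        fin_cases i <;> rfl
      · congr 1
        ext i
        fin_cases i <;> rfl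
    refine ⟨A, ?_, 1, 0, 0, 1, by norm_num, ?_, ?_⟩
    · have hdet := ε.map_det_mul b (A : V →ₗ[ℝ] V)
      have hw : wedge ω' ω' (fun i => A (b i)) = wedge ω ω b := by
        simp only [wedge_two_two_apply_s8, hωA]
      rw [hB, hB, AlternatingMap.smul_apply, AlternatingMap.smul_apply] at hw
      simp only [LinearEquiv.coe_coe] at hdet
      rw [hdet, smul_eq_mul, smul_eq_mul, ← mul_assoc] at hw
      have := mul_right_cancel₀ hb hw
      exact pos_of_mul_pos_right (this ▸ h₂) h₂'.le
    · rw [hpull hωA]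
      simp
    · rw [hpull hφA]
      simp
end

section
/- Let ω₀ = e¹∧e³ − e²∧e⁴ and φ₀ = e¹∧e⁴ + e²∧e³ on ℝ⁴. Suppose A : ℝ⁴ → ℝ⁴ is a linear map, x, y are nonzero real numbers, and α, β are nonnegative real numbers such that A*ω₀ = xω₀ and A*(αω₀ + φ₀) = y(βω₀ + φ₀). Then x² = y² and α = β. -/
open scoped TensorProduct

/-- A linear functional regarded as an alternating `1`-form. -/
noncomputable def oneForm {V : Type*} [AddCommGroup V] [Module ℝ V]
    (a : V →ₗ[ℝ] ℝ) : V [⋀^Fin 1]→ₗ[ℝ] ℝ :=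
  AlternatingMap.ofSubsingleton ℝ V ℝ 0 a

/-- The wedge product of two linear functionals, as an alternating `2`-form. -/
noncomputable def wedge11 {V : Type*} [AddCommGroup V] [Module ℝ V]
    (a b : V →ₗ[ℝ] ℝ) : V [⋀^Fin 2]→ₗ[ℝ] ℝ :=
  wedge (oneForm a) (oneForm b)

/-- The `2`-form `ω₀ = e¹∧e³ − e²∧e⁴` on `ℝ⁴`. -/
noncomputable def omega0 : (Fin 4 → ℝ) [⋀^Fin 2]→ₗ[ℝ] ℝ :=
  wedge11 (LinearMap.proj 0) (LinearMap.proj 2) -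
    wedge11 (LinearMap.proj 1) (LinearMap.proj 3)

/-- The `2`-form `φ₀ = e¹∧e⁴ + e²∧e³` on `ℝ⁴`. -/
noncomputable def phi0 : (Fin 4 → ℝ) [⋀^Fin 2]→ₗ[ℝ] ℝ :=
  wedge11 (LinearMap.proj 0) (LinearMap.proj 3) +
    wedge11 (LinearMap.proj 1) (LinearMap.proj 2)

theorem wedge11_apply {V : Type*} [AddCommGroup V] [Module ℝ V]
    (a b : V →ₗ[ℝ] ℝ) (v : Fin 2 → V) :
    wedge11 a b v = a (v 0) * b (v 1) - a (v 1) * b (v 0) := by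
  have h := MultilinearMap.domCoprod_alternization_eq (oneForm a) (oneForm b)
  simp only [Fintype.card_fin, Nat.factorial_one, mul_one, one_smul] at h
  have hw : wedge11 a b v = TensorProduct.lid ℝ ℝ
      ((oneForm a).domCoprod (oneForm b) (v ∘ finSumFinEquiv)) := rfl
  have huniv : (Finset.univ : Finset (Equiv.Perm (Fin 1 ⊕ Fin 1))) =
      {1, Equiv.swap (Sum.inl 0) (Sum.inr 0)} := by decide
  have hne : (1 : Equiv.Perm (Fin 1 ⊕ Fin 1)) ≠ Equiv.swap (Sum.inl 0) (Sum.inr 0) := by decide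
  have h0 : (finSumFinEquiv (Sum.inl 0 : Fin 1 ⊕ Fin 1) : Fin 2) = 0 := rfl
  have h1 : (finSumFinEquiv (Sum.inr 0 : Fin 1 ⊕ Fin 1) : Fin 2) = 1 := rfl
  rw [hw, ← h, MultilinearMap.alternatization_apply, huniv, Finset.sum_pair hne]
  simp [oneForm, h0, h1, sub_eq_add_neg]

theorem compLinearMap_apply_pair {V W : Type*} [AddCommGroup V] [Module ℝ V]
    [AddCommGroup W] [Module ℝ W] (ω : W [⋀^Fin 2]→ₗ[ℝ] ℝ) (A : V →ₗ[ℝ] W) (v w : V) :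
    ω.compLinearMap A ![v, w] = ω ![A v, A w] := by
  rw [AlternatingMap.compLinearMap_apply]
  congr 1
  ext k : 1
  fin_cases k <;> rfl

theorem omega0_apply (v w : Fin 4 → ℝ) :
    omega0 ![v, w] = v 0 * w 2 - w 0 * v 2 - (v 1 * w 3 - w 1 * v 3) := by
  simp [omega0, wedge11_apply]

theorem phi0_apply (v w : Fin 4 → ℝ) :
    phi0 ![v, w] = v 0 * w 3 - w 0 * v 3 + (v 1 * w 2 - w 1 * v 2) := by
  simp [phi0, wedge11_apply]

/-- On any four vectors `ω₀ ∧ ω₀` and `φ₀ ∧ φ₀` agree. -/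
theorem omega0_wedge_self_eq_phi0_wedge_self (p q r s : Fin 4 → ℝ) :
    omega0 ![p, q] * omega0 ![r, s] - omega0 ![p, r] * omega0 ![q, s] +
        omega0 ![p, s] * omega0 ![q, r] =
      phi0 ![p, q] * phi0 ![r, s] - phi0 ![p, r] * phi0 ![q, s] +
        phi0 ![p, s] * phi0 ![q, r] := by
  simp only [omega0_apply, phi0_apply]
  ring

/-- On any four vectors `ω₀ ∧ φ₀` vanishes. -/
theorem omega0_wedge_phi0 (p q r s : Fin 4 → ℝ) :
    omega0 ![p, q] * phi0 ![r, s] - omega0 ![p, r] * phi0 ![q, s] +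
        omega0 ![p, s] * phi0 ![q, r] + omega0 ![r, s] * phi0 ![p, q] -
        omega0 ![q, s] * phi0 ![p, r] + omega0 ![q, r] * phi0 ![p, s] = 0 := by
  simp only [omega0_apply, phi0_apply]
  ring

/-- if a linear map `A : ℝ⁴ → ℝ⁴` satisfies `A*ω₀ = xω₀` and
`A*(αω₀ + φ₀) = y(βω₀ + φ₀)` for some nonzero reals `x, y` and nonnegative reals
`α, β`, then `x² = y²` and `α = β`. -/
theorem stmt10 (A : (Fin 4 → ℝ) →ₗ[ℝ] (Fin 4 → ℝ))
    (x y : ℝ) (hx : x ≠ 0) (hy : y ≠ 0)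
    (a b : ℝ) (ha : 0 ≤ a) (hb : 0 ≤ b)
    (h1 : omega0.compLinearMap A = x • omega0)
    (h2 : (a • omega0 + phi0).compLinearMap A = y • (b • omega0 + phi0)) :
    x ^ 2 = y ^ 2 ∧ a = b := by
  let e (i : Fin 4) : Fin 4 → ℝ := Pi.single i 1
  have hω (i j : Fin 4) : omega0 ![A (e i), A (e j)] = x * omega0 ![e i, e j] := by
    have h := DFunLike.congr_fun h1 ![e i, e j]
    rwa [compLinearMap_apply_pair] at h
  have hφ (i j : Fin 4) : phi0 ![A (e i), A (e j)] =
      y * (b * omega0 ![e i, e j] + phi0 ![e i, e j]) - a * (x * omega0 ![e i, e j]) := by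
    have h := DFunLike.congr_fun h2 ![e i, e j]
    rw [← hω, eq_sub_iff_add_eq']
    rw [compLinearMap_apply_pair] at h
    simpa [mul_add] using h
  have hself := omega0_wedge_self_eq_phi0_wedge_self (A (e 0)) (A (e 1)) (A (e 2)) (A (e 3))
  have hmix := omega0_wedge_phi0 (A (e 0)) (A (e 1)) (A (e 2)) (A (e 3))
  simp only [hω, hφ] at hself hmix
  simp [omega0_apply, phi0_apply, e] at hself hmix
  have hba : y * b = a * x := by
    have : x * (y * b - a * x) = 0 := by linear_combination hmix / 2
    exact sub_eq_zero.mp ((mul_eq_zero.mp this).resolve_left hx)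
  have hxy : x ^ 2 = y ^ 2 := by
    linear_combination hself + (y * b - a * x) * hba
  refine ⟨hxy, ?_⟩
  have hsq : y ^ 2 * a ^ 2 = y ^ 2 * b ^ 2 := by
    linear_combination -(y * b + a * x) * hba - a ^ 2 * hxy
  exact (sq_eq_sq₀ ha hb).mp (mul_left_cancel₀ (pow_ne_zero 2 hy) hsq)
end

section
/- Let M be a smooth 3-manifold and β₁, β₂ smooth 2-forms on M that are linearly independent at every point. Then every point of M has an open neighbourhood on which there exists a smooth coframing η = (η₁, η₂, η₃) (three pointwise linearly independent smooth 1-forms) such that β₁ = η₂∧η₁ and β₂ = η₂∧η₃. -/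
open scoped ContDiff

/-- The components of the vector field dual to a `2`-form on `ℝ³` with respect to the standard
volume form. -/
noncomputable def dualComponents
    (B : EuclideanSpace ℝ (Fin 3) →L[ℝ] (EuclideanSpace ℝ (Fin 3) →L[ℝ] ℝ)) : Fin 3 → ℝ :=
  ![B (EuclideanSpace.single 1 1) (EuclideanSpace.single 2 1),
    B (EuclideanSpace.single 2 1) (EuclideanSpace.single 0 1),
    B (EuclideanSpace.single 0 1) (EuclideanSpace.single 1 1)]

theorem apply_eq_dualComponents
    (B : EuclideanSpace ℝ (Fin 3) →L[ℝ] (EuclideanSpace ℝ (Fin 3) →L[ℝ] ℝ))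
    (hB : ∀ v w, B v w = -B w v) (v w : EuclideanSpace ℝ (Fin 3)) :
    B v w = dualComponents B 0 * (v 1 * w 2 - v 2 * w 1) +
      dualComponents B 1 * (v 2 * w 0 - v 0 * w 2) +
      dualComponents B 2 * (v 0 * w 1 - v 1 * w 0) := by
  have expand : ∀ u : EuclideanSpace ℝ (Fin 3),
      u = u 0 • EuclideanSpace.single 0 1 + u 1 • EuclideanSpace.single 1 1 +
        u 2 • EuclideanSpace.single 2 1 := by
    intro u
    ext i
    fin_cases i <;> simp
  have diag : ∀ u, B u u = 0 := fun u => by linarith [hB u u]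
  conv_lhs => rw [expand v, expand w]
  simp only [map_add, map_smul, add_apply, smul_apply, smul_eq_mul, diag, dualComponents,
    Matrix.cons_val]
  rw [hB (EuclideanSpace.single 2 1) (EuclideanSpace.single 1 1),
    hB (EuclideanSpace.single 0 1) (EuclideanSpace.single 2 1),
    hB (EuclideanSpace.single 1 1) (EuclideanSpace.single 0 1)]
  ring

/-- The covector annihilating the vectors dual to two given `2`-forms on `ℝ³`. -/
noncomputable def commonFactor
    (B C : EuclideanSpace ℝ (Fin 3) →L[ℝ] (EuclideanSpace ℝ (Fin 3) →L[ℝ] ℝ)) :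
    EuclideanSpace ℝ (Fin 3) →L[ℝ] ℝ :=
  ∑ i, (crossProduct (dualComponents B) (dualComponents C)) i • EuclideanSpace.proj i

theorem commonFactor_mul_apply
    (B C : EuclideanSpace ℝ (Fin 3) →L[ℝ] (EuclideanSpace ℝ (Fin 3) →L[ℝ] ℝ))
    (hB : ∀ v w, B v w = -B w v) (hC : ∀ v w, C v w = -C w v)
    (e v w : EuclideanSpace ℝ (Fin 3)) :
    commonFactor B C e * B v w = commonFactor B C v * B e w - commonFactor B C w * B e v ∧
    commonFactor B C e * C v w = commonFactor B C v * C e w - commonFactor B C w * C e v := by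
  rw [apply_eq_dualComponents B hB v w, apply_eq_dualComponents B hB e w,
    apply_eq_dualComponents B hB e v, apply_eq_dualComponents C hC v w,
    apply_eq_dualComponents C hC e w, apply_eq_dualComponents C hC e v]
  simp only [commonFactor, Fin.sum_univ_three, cross_apply, add_apply, smul_apply, smul_eq_mul,
    PiLp.proj_apply, Matrix.cons_val]
  constructor <;> ring

theorem exists_commonFactor_ne_zero
    (B C : EuclideanSpace ℝ (Fin 3) →L[ℝ] (EuclideanSpace ℝ (Fin 3) →L[ℝ] ℝ))
    (hB : ∀ v w, B v w = -B w v) (hC : ∀ v w, C v w = -C w v)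
    (hind : ∀ a b : ℝ, (∀ v w, a * B v w + b * C v w = 0) → a = 0 ∧ b = 0) :
    ∃ e, commonFactor B C e ≠ 0 := by
  have hne : crossProduct (dualComponents B) (dualComponents C) ≠ 0 := by
    rw [crossProduct_ne_zero_iff_linearIndependent, LinearIndependent.pair_iff]
    intro a b hab
    refine hind a b fun v w => ?_
    have hi : ∀ i, a * dualComponents B i + b * dualComponents C i = 0 := fun i =>
      congrFun hab i
    rw [apply_eq_dualComponents B hB v w, apply_eq_dualComponents C hC v w]
    linear_combination (v 1 * w 2 - v 2 * w 1) * hi 0 + (v 2 * w 0 - v 0 * w 2) * hi 1 +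
      (v 0 * w 1 - v 1 * w 0) * hi 2
  obtain ⟨i, hi⟩ := Function.ne_iff.mp hne
  refine ⟨EuclideanSpace.single i 1, ?_⟩
  simpa [commonFactor, Pi.single_apply] using hi

theorem ContDiffOn.commonFactor {n : WithTop ℕ∞} {U : Set (EuclideanSpace ℝ (Fin 3))}
    {β γ : EuclideanSpace ℝ (Fin 3) →
      (EuclideanSpace ℝ (Fin 3) →L[ℝ] (EuclideanSpace ℝ (Fin 3) →L[ℝ] ℝ))}
    (hβ : ContDiffOn ℝ n β U) (hγ : ContDiffOn ℝ n γ U) :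
    ContDiffOn ℝ n (fun q => _root_.commonFactor (β q) (γ q)) U := by
  unfold _root_.commonFactor
  simp only [Fin.sum_univ_three, cross_apply, dualComponents, Matrix.cons_val]
  fun_prop

/-- Lemma on adapted coframings: on a smooth `3`-manifold — modelled,
since the statement is purely local, by an open set `U` in `ℝ³`, a chart identifying
`2`-forms with smooth antisymmetric bilinear-form-valued maps — given two smooth
`2`-forms `β₁, β₂` that are linearly independent at every point, every point has an
open neighbourhood carrying a smooth coframing `(η₁, η₂, η₃)` (three pointwise
linearly independent smooth `1`-forms) with `β₁ = η₂∧η₁` and `β₂ = η₂∧η₃`. -/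
theorem stmt11
    (U : Set (EuclideanSpace ℝ (Fin 3))) (hU : IsOpen U)
    (β₁ β₂ : EuclideanSpace ℝ (Fin 3) →
      (EuclideanSpace ℝ (Fin 3) →L[ℝ] (EuclideanSpace ℝ (Fin 3) →L[ℝ] ℝ)))
    (hβ₁s : ContDiffOn ℝ ∞ β₁ U) (hβ₂s : ContDiffOn ℝ ∞ β₂ U)
    (halt₁ : ∀ p ∈ U, ∀ v w, β₁ p v w = -β₁ p w v)
    (halt₂ : ∀ p ∈ U, ∀ v w, β₂ p v w = -β₂ p w v)
    (hindep : ∀ p ∈ U, ∀ a b : ℝ,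
      (∀ v w, a * β₁ p v w + b * β₂ p v w = 0) → a = 0 ∧ b = 0) :
    ∀ p ∈ U, ∃ W : Set (EuclideanSpace ℝ (Fin 3)), IsOpen W ∧ p ∈ W ∧ W ⊆ U ∧
      ∃ η₁ η₂ η₃ : EuclideanSpace ℝ (Fin 3) → (EuclideanSpace ℝ (Fin 3) →L[ℝ] ℝ),
        ContDiffOn ℝ ∞ η₁ W ∧ ContDiffOn ℝ ∞ η₂ W ∧ ContDiffOn ℝ ∞ η₃ W ∧
        (∀ q ∈ W, LinearIndependent ℝ ![η₁ q, η₂ q, η₃ q]) ∧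
        (∀ q ∈ W, ∀ v w,
          β₁ q v w = η₂ q v * η₁ q w - η₂ q w * η₁ q v ∧
          β₂ q v w = η₂ q v * η₃ q w - η₂ q w * η₃ q v) := by
  intro p hp
  obtain ⟨e, he⟩ := exists_commonFactor_ne_zero (β₁ p) (β₂ p) (halt₁ p hp) (halt₂ p hp)
    (hindep p hp)
  have hc := hβ₁s.commonFactor hβ₂s
  have hce : ContDiffOn ℝ ∞ (fun q => commonFactor (β₁ q) (β₂ q) e) U :=
    hc.clm_apply contDiffOn_const
  have hsub : U ∩ (fun q => commonFactor (β₁ q) (β₂ q) e) ⁻¹' {0}ᶜ ⊆ U := Set.inter_subset_left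
  refine ⟨U ∩ (fun q => commonFactor (β₁ q) (β₂ q) e) ⁻¹' {0}ᶜ,
    hce.continuousOn.isOpen_inter_preimage hU isOpen_compl_singleton, ⟨hp, he⟩, hsub,
    fun q => β₁ q e,
    fun q => (commonFactor (β₁ q) (β₂ q) e)⁻¹ • commonFactor (β₁ q) (β₂ q),
    fun q => β₂ q e, (hβ₁s.mono hsub).clm_apply contDiffOn_const,
    ((hce.mono hsub).inv fun q hq => hq.2).smul (hc.mono hsub),
    (hβ₂s.mono hsub).clm_apply contDiffOn_const, ?_⟩
  have hwedge : ∀ q ∈ U ∩ (fun q => commonFactor (β₁ q) (β₂ q) e) ⁻¹' {0}ᶜ, ∀ v w,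
      β₁ q v w = ((commonFactor (β₁ q) (β₂ q) e)⁻¹ • commonFactor (β₁ q) (β₂ q)) v * β₁ q e w -
        ((commonFactor (β₁ q) (β₂ q) e)⁻¹ • commonFactor (β₁ q) (β₂ q)) w * β₁ q e v ∧
      β₂ q v w = ((commonFactor (β₁ q) (β₂ q) e)⁻¹ • commonFactor (β₁ q) (β₂ q)) v * β₂ q e w -
        ((commonFactor (β₁ q) (β₂ q) e)⁻¹ • commonFactor (β₁ q) (β₂ q)) w * β₂ q e v := by
    rintro q ⟨hqU, hq⟩ v w
    replace hq : commonFactor (β₁ q) (β₂ q) e ≠ 0 := hq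
    obtain ⟨h₁, h₂⟩ :=
      commonFactor_mul_apply (β₁ q) (β₂ q) (halt₁ q hqU) (halt₂ q hqU) e v w
    simp only [smul_apply, smul_eq_mul]
    constructor
    · field_simp
      linear_combination h₁
    · field_simp
      linear_combination h₂
  refine ⟨fun q hq => ?_, hwedge⟩
  have hqe : commonFactor (β₁ q) (β₂ q) e ≠ 0 := hq.2
  rw [Fintype.linearIndependent_iff]
  intro g hg
  have happ : ∀ v, g 0 * β₁ q e v +
      g 1 * ((commonFactor (β₁ q) (β₂ q) e)⁻¹ * commonFactor (β₁ q) (β₂ q) v) +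
      g 2 * β₂ q e v = 0 := fun v => by
    simpa [Fin.sum_univ_three] using DFunLike.congr_fun hg v
  have hg₁ : g 1 = 0 := by
    have h₁ : β₁ q e e = 0 := by linarith [halt₁ q hq.1 e e]
    have h₂ : β₂ q e e = 0 := by linarith [halt₂ q hq.1 e e]
    simpa [h₁, h₂, hqe] using happ e
  simp only [hg₁, zero_mul, add_zero] at happ
  obtain ⟨hg₀, hg₂⟩ := hindep q hq.1 (g 0) (g 2) fun v w => by
    rw [(hwedge q hq v w).1, (hwedge q hq v w).2]
    linear_combination
      ((commonFactor (β₁ q) (β₂ q) e)⁻¹ • commonFactor (β₁ q) (β₂ q)) v * happ w -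
      ((commonFactor (β₁ q) (β₂ q) e)⁻¹ • commonFactor (β₁ q) (β₂ q)) w * happ v
  intro i
  fin_cases i
  exacts [hg₀, hg₁, hg₂]
end

section
/- Let (M, P₁, P₂) be a real analytic path geometry on a 3-manifold M. Then for every point p ∈ M there exists an open neighbourhood U_p ⊂ M of p and a real analytic embedding φ : U_p → ℂ², such that the path geometry induced on φ(U_p) ≅ U_p by the splitting ({ω₀},{φ₀}) of the standard complex structure of ℂ² coincides with (P₁, P₂) on U_p. Here ω₀ = Re(dz¹∧dz²) and φ₀ = Im(dz¹∧dz²) in standard coordinates (z¹,z²) on ℂ². -/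
/-- `ω₀ = Re(dz¹∧dz²)` on `ℂ²`, evaluated on a pair of tangent vectors. -/
noncomputable def omegaC (u v : Fin 2 → ℂ) : ℝ := (u 0 * v 1 - u 1 * v 0).re

/-- `φ₀ = Im(dz¹∧dz²)` on `ℂ²`, evaluated on a pair of tangent vectors. -/
noncomputable def phiC (u v : Fin 2 → ℂ) : ℝ := (u 0 * v 1 - u 1 * v 0).im

section

open scoped Topology ContDiff unitInterval

/-- The superposition operator of an analytic map is analytic at constant maps. -/
theorem AnalyticAt.exists_analyticAt_superposition {𝕜 K E F : Type*} [NontriviallyNormedField 𝕜]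
    [TopologicalSpace K] [CompactSpace K]
    [NormedAddCommGroup E] [NormedSpace 𝕜 E] [NormedAddCommGroup F] [NormedSpace 𝕜 F]
    [CompleteSpace F] {V : E → F} {p : E} (hV : AnalyticAt 𝕜 V p) :
    ∃ N : C(K, E) → C(K, F), AnalyticAt 𝕜 N (ContinuousMap.const K p) ∧
      ∀ᶠ γ in 𝓝 (ContinuousMap.const K p), ∀ s, N γ s = V (γ s) := by
  obtain ⟨P, r, hP⟩ := hV
  let q : FormalMultilinearSeries 𝕜 C(K, E) C(K, F) := fun n =>
    MultilinearMap.mkContinuous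
      { toFun := fun m => ⟨fun s => P n (fun i => m i s), by fun_prop⟩
        map_update_add' := by
          intro _ m i x y
          ext s
          have h : ∀ z : C(K, E), (fun j => (Function.update m i z) j s) =
              Function.update (fun j => m j s) i (z s) := fun z => by
            ext j
            by_cases hj : j = i
            · subst hj; simp
            · simp [hj]
          simp [h]
        map_update_smul' := by
          intro _ m i c x
          ext s
          have h : ∀ z : C(K, E), (fun j => (Function.update m i z) j s) =
              Function.update (fun j => m j s) i (z s) := fun z => by
            ext j
            by_cases hj : j = i
            · subst hj; simp
            · simp [hj]
          simp [h] } ‖P n‖ (by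
        intro m
        refine (ContinuousMap.norm_le _ (by positivity)).2 fun s => ?_
        refine ((P n).le_opNorm _).trans ?_
        gcongr with i
        exact (m i).norm_coe_le_norm s)
  have hq : ∀ n m s, q n m s = P n (fun i => m i s) := fun n m s => rfl
  have hrad : P.radius ≤ q.radius := by
    refine ENNReal.le_of_forall_nnreal_lt fun ρ hρ => ?_
    obtain ⟨C, -, hC⟩ := P.norm_mul_pow_le_of_lt_radius hρ
    refine q.le_radius_of_bound C fun n => le_trans ?_ (hC n)
    gcongr
    exact MultilinearMap.mkContinuous_norm_le _ (norm_nonneg _) _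
  have hr : 0 < q.radius := hP.r_pos.trans_le (hP.r_le.trans hrad)
  have hsum := q.hasFPowerSeriesOnBall hr
  refine ⟨fun γ => q.sum (γ - ContinuousMap.const K p), ?_, ?_⟩
  · have h := hsum.comp_sub (ContinuousMap.const K p)
    rw [zero_add] at h
    exact h.analyticAt
  · filter_upwards [Metric.eball_mem_nhds (ContinuousMap.const K p) hP.r_pos] with γ hγ s
    have hγ' : γ - ContinuousMap.const K p ∈ Metric.eball (0 : C(K, E)) r := by
      simpa [edist_eq_enorm_sub] using hγ
    have h1 := hsum.hasSum (Metric.eball_subset_eball (hP.r_le.trans hrad) hγ')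
    have h2 := (ContinuousMap.evalCLM 𝕜 s).hasSum h1
    have hs : γ s - p ∈ Metric.eball (0 : E) r := by
      simp only [Metric.mem_eball, edist_zero_right] at hγ' ⊢
      refine lt_of_le_of_lt ?_ hγ'
      rw [enorm_le_iff_norm_le]
      exact (γ - ContinuousMap.const K p).norm_coe_le_norm s
    have h3 := hP.hasSum hs
    simp only [add_sub_cancel, zero_add] at h2 h3
    exact h2.unique h3

/-- The primitive vanishing at `0` of a continuous curve on the unit interval. -/
noncomputable def primitiveCLM (𝕜 E : Type*) [RCLike 𝕜] [NormedAddCommGroup E] [NormedSpace 𝕜 E]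
    [NormedSpace ℝ E] [SMulCommClass ℝ 𝕜 E] : C(I, E) →L[𝕜] C(I, E) :=
  LinearMap.mkContinuous
    { toFun := fun γ => ⟨fun s => ∫ τ in (0 : ℝ)..s, Set.IccExtend zero_le_one γ τ,
        (intervalIntegral.continuous_primitive
          (fun _ _ => γ.continuous.Icc_extend'.intervalIntegrable _ _) 0).comp
            continuous_subtype_val⟩
      map_add' := fun γ η => by
        ext s
        exact intervalIntegral.integral_add
          (γ.continuous.Icc_extend'.intervalIntegrable _ _)
          (η.continuous.Icc_extend'.intervalIntegrable _ _)
      map_smul' := fun c γ => by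
        ext s
        exact intervalIntegral.integral_smul c _ } 1 (fun γ => by
      refine (ContinuousMap.norm_le _ (by positivity)).2 fun s => ?_
      refine (intervalIntegral.norm_integral_le_of_norm_le_const (C := ‖γ‖)
        fun τ _ => γ.norm_coe_le_norm _).trans ?_
      rw [sub_zero, abs_of_nonneg s.2.1, mul_comm]
      exact mul_le_mul_of_nonneg_right s.2.2 (norm_nonneg _))

theorem primitiveCLM_apply {𝕜 E : Type*} [RCLike 𝕜] [NormedAddCommGroup E] [NormedSpace 𝕜 E]
    [NormedSpace ℝ E] [SMulCommClass ℝ 𝕜 E] (γ : C(I, E)) (s : I) :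
    primitiveCLM 𝕜 E γ s = ∫ τ in (0 : ℝ)..s, Set.IccExtend zero_le_one γ τ := rfl

theorem primitiveCLM_comp_mul {𝕜 E : Type*} [RCLike 𝕜] [NormedAddCommGroup E] [NormedSpace 𝕜 E]
    [NormedSpace ℝ E] [SMulCommClass ℝ 𝕜 E] (γ : C(I, E)) (c s : I) :
    (c : ℝ) • primitiveCLM 𝕜 E (γ.comp ⟨fun τ => c * τ, by fun_prop⟩) s =
      primitiveCLM 𝕜 E γ (c * s) := by
  rw [primitiveCLM_apply, primitiveCLM_apply]
  have h := intervalIntegral.smul_integral_comp_mul_left (a := 0) (b := s)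
    (Set.IccExtend zero_le_one γ) (c : ℝ)
  rw [mul_zero] at h
  rw [Set.Icc.coe_mul, ← h]
  congr 1
  refine intervalIntegral.integral_congr fun τ hτ => ?_
  rw [Set.uIcc_of_le s.2.1] at hτ
  have hτ' : τ ∈ I := ⟨hτ.1, hτ.2.trans s.2.2⟩
  have hc : (c : ℝ) * τ ∈ I := unitInterval.mul_mem c.2 hτ'
  rw [Set.IccExtend_of_mem _ _ hτ', Set.IccExtend_of_mem _ _ hc]
  rfl

theorem hasDerivWithinAt_primitiveCLM_one {𝕜 E : Type*} [RCLike 𝕜] [NormedAddCommGroup E]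
    [NormedSpace 𝕜 E] [NormedSpace ℝ E] [SMulCommClass ℝ 𝕜 E] [CompleteSpace E] (γ : C(I, E)) :
    HasDerivWithinAt (fun c : ℝ => Set.IccExtend zero_le_one (primitiveCLM 𝕜 E γ) c) (γ 1) I 1 := by
  have hc := γ.continuous.Icc_extend' (h := zero_le_one)
  have h := intervalIntegral.integral_hasDerivAt_right (hc.intervalIntegrable (0 : ℝ) 1)
    (hc.stronglyMeasurableAtFilter _ _) hc.continuousAt
  have h1 : Set.IccExtend zero_le_one γ 1 = γ 1 := Set.IccExtend_right _ _
  rw [h1] at h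
  refine h.hasDerivWithinAt.congr_of_mem (fun c hc => ?_) (Set.right_mem_Icc.2 zero_le_one)
  rw [Set.IccExtend_of_mem _ _ hc]
  rfl

/-- **Analytic local flow** of an analytic vector field. -/
theorem AnalyticAt.exists_analyticAt_flow {𝕜 E : Type*} [RCLike 𝕜] [NormedAddCommGroup E]
    [NormedSpace 𝕜 E] [NormedSpace ℝ E] [IsScalarTower ℝ 𝕜 E] [CompleteSpace E]
    {V : E → E} {p : E} (hV : AnalyticAt 𝕜 V p) :
    ∃ φ : 𝕜 × E → E, AnalyticAt 𝕜 φ (0, p) ∧ (∀ᶠ x in 𝓝 p, φ (0, x) = x) ∧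
      ∀ᶠ z in 𝓝 ((0 : 𝕜), p), fderiv 𝕜 φ z (1, 0) = V (φ z) := by
  have : SMulCommClass ℝ 𝕜 E := IsScalarTower.to_smulCommClass
  obtain ⟨N, hN, hNV⟩ := hV.exists_analyticAt_superposition (K := I)
  let cst : E →L[𝕜] C(I, E) := ContinuousLinearMap.const 𝕜 I
  let f : (𝕜 × E) × C(I, E) → C(I, E) := fun u =>
    u.2 - cst u.1.2 - u.1.1 • primitiveCLM 𝕜 E (N u.2)
  let u : (𝕜 × E) × C(I, E) := ((0, p), cst p)
  have hfu : f u = 0 := by simp [f, u]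
  have hfan : AnalyticAt 𝕜 f u := by
    have hN' : AnalyticAt 𝕜 N u.2 := hN
    have h2 : AnalyticAt 𝕜 (fun v : (𝕜 × E) × C(I, E) => N v.2) u :=
      hN'.fun_comp analyticAt_snd
    have h3 : AnalyticAt 𝕜 (fun v : (𝕜 × E) × C(I, E) => primitiveCLM 𝕜 E (N v.2)) u :=
      ((primitiveCLM 𝕜 E).analyticAt _).fun_comp h2
    have h4 : AnalyticAt 𝕜 (fun v : (𝕜 × E) × C(I, E) => cst v.1.2) u :=
      (cst.analyticAt _).fun_comp (analyticAt_snd.fun_comp analyticAt_fst)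
    exact (analyticAt_snd.sub h4).sub ((analyticAt_fst.fun_comp analyticAt_fst).smul h3)
  have hcdf : ContDiffAt 𝕜 ω f u := hfan.contDiffAt
  have hid : fderiv 𝕜 f u ∘L .inr 𝕜 (𝕜 × E) C(I, E) = .id 𝕜 _ := by
    have h1 : HasFDerivAt f (fderiv 𝕜 f u) ((0, p), cst p) :=
      hfan.differentiableAt.hasFDerivAt
    have h2 := h1.comp (cst p) (hasFDerivAt_prodMk_right ((0 : 𝕜), p) (cst p))
    have h3 : f ∘ (fun γ => (((0 : 𝕜), p), γ)) = fun γ => γ - cst p := by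
      ext γ; simp [f]
    rw [h3] at h2
    exact h2.unique ((hasFDerivAt_id _).sub_const _)
  have hinv : (fderiv 𝕜 f u ∘L .inr 𝕜 (𝕜 × E) C(I, E)).IsInvertible := by
    rw [hid]; exact ⟨.refl 𝕜 _, rfl⟩
  have hω : (ω : WithTop ℕ∞) ≠ 0 := by simp
  let Γ : 𝕜 × E → C(I, E) := hcdf.implicitFunction hω hinv
  have hΓan : AnalyticAt 𝕜 Γ (0, p) := (hcdf.contDiffAt_implicitFunction hω hinv).analyticAt
  have hΓu : Γ (0, p) = cst p := hcdf.implicitFunction_apply_self hω hinv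
  have hsol : ∀ᶠ z in 𝓝 ((0 : 𝕜), p), f (z, Γ z) = 0 := by
    simpa only [hfu] using hcdf.eventually_apply_implicitFunction hω hinv
  have huniq : ∀ᶠ v in 𝓝 u, f v = 0 ↔ Γ v.1 = v.2 := by
    simpa only [hfu] using hcdf.eventually_apply_eq_iff_implicitFunction hω hinv
  have hN2 : ∀ᶠ v in 𝓝 u, ∀ s, N v.2 s = V (v.2 s) :=
    (continuous_snd.tendsto u).eventually hNV
  obtain ⟨δ, hδ, hball⟩ := Metric.eventually_nhds_iff_ball.1 (huniq.and hN2)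
  have hΓu' : ∀ᶠ z in 𝓝 ((0 : 𝕜), p), (z, Γ z) ∈ Metric.ball u δ := by
    have h : ContinuousAt (fun z => (z, Γ z)) ((0 : 𝕜), p) :=
      continuousAt_id.prodMk hΓan.continuousAt
    have h' := h.tendsto
    rw [hΓu] at h'
    exact h'.eventually (Metric.ball_mem_nhds u hδ)
  let φ : 𝕜 × E → E := fun z => Γ z 1
  have hφan : AnalyticAt 𝕜 φ (0, p) :=
    ((ContinuousMap.evalCLM 𝕜 (1 : I)).analyticAt _).fun_comp hΓan
  have hφ0 : ∀ᶠ x in 𝓝 p, φ (0, x) = x := by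
    have h : Filter.Tendsto (fun x : E => ((0 : 𝕜), x)) (𝓝 p) (𝓝 (0, p)) :=
      (Continuous.prodMk_right (0 : 𝕜)).tendsto p
    filter_upwards [h.eventually hsol] with x hx
    have : Γ (0, x) = cst x := by simpa [f, sub_eq_zero] using hx
    simp [φ, this, cst]
  have hscale : ∀ᶠ z in 𝓝 ((0 : 𝕜), p), ∀ c : I,
      φ ((c : ℝ) • z.1, z.2) = z.2 + z.1 • primitiveCLM 𝕜 E (N (Γ z)) c := by
    filter_upwards [hΓu', hsol] with z hz hz0 c
    obtain ⟨t, x⟩ := z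
    let m : C(I, I) := ⟨fun τ => c * τ, by fun_prop⟩
    have hz' : (((c : ℝ) • t, x), (Γ (t, x)).comp m) ∈ Metric.ball u δ := by
      simp only [u, Metric.mem_ball, Prod.dist_eq, max_lt_iff] at hz ⊢
      refine ⟨⟨lt_of_le_of_lt ?_ hz.1.1, hz.1.2⟩, ?_⟩
      · rw [dist_zero_right, dist_zero_right, norm_smul, Real.norm_eq_abs, abs_of_nonneg c.2.1]
        exact mul_le_of_le_one_left (norm_nonneg _) c.2.2
      · refine lt_of_le_of_lt ((ContinuousMap.dist_le dist_nonneg).2 fun s => ?_) hz.2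
        exact ContinuousMap.dist_apply_le_dist (f := Γ (t, x)) (g := cst p) (m s)
    obtain ⟨h1, h2⟩ := hball _ hz'
    have h3 : ∀ s, N (Γ (t, x)) s = V (Γ (t, x) s) := (hball _ hz).2
    have h4 : N ((Γ (t, x)).comp m) = (N (Γ (t, x))).comp m := by
      ext s
      rw [h2 s, ContinuousMap.comp_apply, ContinuousMap.comp_apply, h3]
    have h5 : ∀ s, Γ (t, x) s = x + t • primitiveCLM 𝕜 E (N (Γ (t, x))) s := fun s => by
      have := congrArg (fun γ : C(I, E) => γ s) hz0
      simp only [f, ContinuousMap.sub_apply, ContinuousMap.zero_apply,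
        sub_sub, sub_eq_zero] at this
      exact this
    have h6 : f (((c : ℝ) • t, x), (Γ (t, x)).comp m) = 0 := by
      ext s
      have h7 := primitiveCLM_comp_mul (𝕜 := 𝕜) (N (Γ (t, x))) c s
      have h8 : (Γ (t, x)).comp m s = x + t • primitiveCLM 𝕜 E (N (Γ (t, x))) (c * s) := h5 _
      simp only [f, ContinuousMap.sub_apply, ContinuousMap.zero_apply,
        sub_sub, sub_eq_zero, h4]
      rw [h8, ← h7, smul_assoc, smul_comm]
      rfl
    have h9 := h1.1 h6
    change Γ ((c : ℝ) • t, x) 1 = _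
    rw [h9]
    refine (h5 (c * 1)).trans ?_
    rw [mul_one]
  have hder : ∀ᶠ z in 𝓝 ((0 : 𝕜), p), z.1 • fderiv 𝕜 φ z (1, 0) = z.1 • V (φ z) := by
    filter_upwards [hscale, hφan.eventually_analyticAt, hΓu'] with z hz hzan hzΓ
    obtain ⟨t, x⟩ := z
    have h1 : HasFDerivAt φ ((fderiv 𝕜 φ (t, x)).restrictScalars ℝ) (((1 : ℝ) • t, x)) := by
      rw [one_smul]
      exact hzan.differentiableAt.hasFDerivAt.restrictScalars ℝ
    have h2 : HasDerivAt (fun c : ℝ => (c • t, x)) (t, (0 : E)) 1 := by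
      have := ((hasDerivAt_id (1 : ℝ)).smul_const t).prodMk (hasDerivAt_const (1 : ℝ) x)
      simpa using this
    have h3 := (h1.comp_hasDerivAt (1 : ℝ) h2).hasDerivWithinAt (s := I)
    have h4 := ((hasDerivWithinAt_primitiveCLM_one (𝕜 := 𝕜) (N (Γ (t, x)))).const_smul t).const_add
      x
    have h5 : HasDerivWithinAt (φ ∘ fun c : ℝ => (c • t, x)) (t • N (Γ (t, x)) 1) I 1 := by
      refine h4.congr_of_mem (fun c hc => ?_) (Set.right_mem_Icc.2 zero_le_one)
      simp only [Function.comp, Pi.smul_apply]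
      rw [hz ⟨c, hc⟩, Set.IccExtend_of_mem _ _ hc]
    have h6 := (uniqueDiffOn_Icc_zero_one 1 (Set.right_mem_Icc.2 zero_le_one)).eq_deriv _ h3 h5
    have h7 : (t, (0 : E)) = t • ((1 : 𝕜), (0 : E)) := by simp
    rw [(hball _ hzΓ).2 1, h7, ContinuousLinearMap.coe_restrictScalars', map_smul] at h6
    exact h6
  have hVφ : ∀ᶠ z in 𝓝 ((0 : 𝕜), p), AnalyticAt 𝕜 (fun z => V (φ z)) z := by
    have h : AnalyticAt 𝕜 V (φ (0, p)) := by rwa [hφ0.self_of_nhds]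
    exact (h.fun_comp hφan).eventually_analyticAt
  refine ⟨φ, hφan, hφ0, ?_⟩
  filter_upwards [hder.eventually_nhds, hφan.eventually_analyticAt, hVφ] with z hz hz1 hz2
  have hL : Filter.Tendsto (fun t : 𝕜 => (t, z.2)) (𝓝[≠] z.1) (𝓝 z) :=
    ((Continuous.prodMk_left z.2).tendsto z.1).mono_left nhdsWithin_le_nhds
  have hne : ∀ᶠ t in 𝓝[≠] z.1, t ≠ 0 := by
    by_cases h0 : z.1 = 0
    · rw [h0]; exact self_mem_nhdsWithin
    · exact nhdsWithin_le_nhds (isOpen_ne.mem_nhds h0)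
  have ha : Filter.Tendsto (fun t : 𝕜 => fderiv 𝕜 φ (t, z.2) (1, 0)) (𝓝[≠] z.1)
      (𝓝 (fderiv 𝕜 φ z (1, 0))) :=
    (hz1.fderiv.continuousAt.clm_apply continuousAt_const).tendsto.comp hL
  have hb : Filter.Tendsto (fun t : 𝕜 => V (φ (t, z.2))) (𝓝[≠] z.1) (𝓝 (V (φ z))) :=
    hz2.continuousAt.tendsto.comp hL
  refine tendsto_nhds_unique (ha.congr' ?_) hb
  filter_upwards [hL.eventually hz, hne] with t ht ht0
  exact smul_right_injective E ht0 ht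

/-- An analytic vector field `V` transverse to the level sets of `ℓ` admits an analytic local
projection `g` along its orbits onto the level set of `ℓ` through `p`. -/
theorem AnalyticAt.exists_analyticAt_flow_projection {𝕜 E : Type*} [RCLike 𝕜]
    [NormedAddCommGroup E] [NormedSpace 𝕜 E] [NormedSpace ℝ E] [IsScalarTower ℝ 𝕜 E]
    [CompleteSpace E] {V : E → E} {p : E} (hV : AnalyticAt 𝕜 V p) (l : E →L[𝕜] 𝕜)
    (hl : l (V p) = 1) :
    ∃ g : E → E, AnalyticAt 𝕜 g p ∧ g p = p ∧ (∀ᶠ q in 𝓝 p, l (g q) = l p) ∧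
      (∀ᶠ q in 𝓝 p, fderiv 𝕜 g q (V q) = 0) ∧
      (∀ᶠ q in 𝓝 p, l q = l p → ∀ w, l w = 0 → fderiv 𝕜 g q w = w) ∧
      ∀ h : E → 𝕜, AnalyticAt 𝕜 h p → (∀ᶠ q in 𝓝 p, fderiv 𝕜 h q (V q) = 0) →
        ∀ᶠ q in 𝓝 p, h (g q) = h q := by
  obtain ⟨φ, hφ, hφ0, hφV⟩ := hV.exists_analyticAt_flow
  set e := V p with he
  let π : E → E := fun y => y - l (y - p) • e
  let A : E → 𝕜 × E := fun y => (l (y - p), π y)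
  let π' : E →L[𝕜] E := .id 𝕜 E - l.smulRight e
  have hπ : ∀ y, HasFDerivAt π π' y := fun y =>
    (hasFDerivAt_id y).sub
      ((l.hasFDerivAt.comp y ((hasFDerivAt_id y).sub_const p)).smul_const e)
  have hπan : ∀ y, AnalyticAt 𝕜 π y := fun y =>
    analyticAt_id.sub (((l.analyticAt _).fun_comp (analyticAt_id.sub analyticAt_const)).smul
      analyticAt_const)
  have hA : ∀ y, HasFDerivAt A (l.prod π') y := fun y =>
    (l.hasFDerivAt.comp y ((hasFDerivAt_id y).sub_const p)).prodMk (hπ y)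
  have hAan : ∀ y, AnalyticAt 𝕜 A y := fun y =>
    ((l.analyticAt _).fun_comp (analyticAt_id.sub analyticAt_const)).prod (hπan y)
  have hAp : A p = (0, p) := by simp [A, π]
  have hπe : π' e = 0 := by simp [π', hl]
  have hlπ : ∀ y, l (π y) = l p := fun y => by simp [π, hl]
  have hπp : π p = p := by simp [π]
  have hπl : ∀ y, l y = l p → π y = y := fun y hy => by simp [π, hy]
  let Ψ : E → E := φ ∘ A
  have hΨan : AnalyticAt 𝕜 Ψ p := by
    have : AnalyticAt 𝕜 φ (A p) := by rwa [hAp]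
    exact this.comp (hAan p)
  have hAt : Filter.Tendsto A (𝓝 p) (𝓝 (0, p)) := by
    have := (hAan p).continuousAt.tendsto
    rwa [hAp] at this
  have hΨe : ∀ᶠ y in 𝓝 p, fderiv 𝕜 Ψ y e = V (Ψ y) := by
    filter_upwards [hAt.eventually hφV, hAt.eventually hφ.eventually_analyticAt] with y h1 h2
    rw [(h2.differentiableAt.hasFDerivAt.comp y (hA y)).fderiv]
    simp only [ContinuousLinearMap.comp_apply, ContinuousLinearMap.prod_apply, hπe, hl]
    exact h1
  have hΨl : ∀ᶠ y in 𝓝 p, l y = l p → Ψ y = y := by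
    filter_upwards [hφ0] with y hy hly
    have : A y = (0, y) := by simp [A, hπl y hly, hly]
    simp [Ψ, this, hy]
  have hΨp : Ψ p = p := hΨl.self_of_nhds rfl
  have hφp : φ (0, p) = p := hφ0.self_of_nhds
  have hΨid : HasFDerivAt Ψ ((ContinuousLinearEquiv.refl 𝕜 E : E ≃L[𝕜] E) : E →L[𝕜] E) p := by
    have h1 : HasFDerivAt φ (fderiv 𝕜 φ (0, p)) (0, p) := hφ.differentiableAt.hasFDerivAt
    have h2 : fderiv 𝕜 φ (0, p) ∘L .inr 𝕜 𝕜 E = .id 𝕜 E := by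
      refine (h1.comp p (hasFDerivAt_prodMk_right (0 : 𝕜) p)).unique ?_
      exact (hasFDerivAt_id p).congr_of_eventuallyEq hφ0
    have h3 : HasFDerivAt φ (fderiv 𝕜 φ (0, p)) (A p) := by rwa [hAp]
    convert h3.comp p (hA p) using 1
    ext w
    have h4 : (l w, π' w) = l w • ((1 : 𝕜), (0 : E)) + ContinuousLinearMap.inr 𝕜 𝕜 E (π' w) := by
      simp
    have h5 : fderiv 𝕜 φ (0, p) (ContinuousLinearMap.inr 𝕜 𝕜 E (π' w)) = π' w :=
      DFunLike.congr_fun h2 (π' w)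
    have h6 : fderiv 𝕜 φ (0, p) (1, 0) = e := by rw [hφV.self_of_nhds, hφp]
    simp only [ContinuousLinearMap.comp_apply, ContinuousLinearMap.prod_apply]
    rw [h4, map_add, map_smul, h5, h6]
    simp [π']
  have hω : (ω : WithTop ℕ∞) ≠ 0 := by simp
  have hΨs := hΨan.contDiffAt (n := ω) |>.hasStrictFDerivAt' hΨid hω
  have hΘan' := (hΨan.contDiffAt (n := ω)).to_localInverse hΨid hω
  let Θ : E → E := hΨs.localInverse Ψ _ p
  have hΘan : AnalyticAt 𝕜 Θ p := by
    rw [hΨp] at hΘan'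
    exact hΘan'.analyticAt
  have hΘΨ : ∀ᶠ y in 𝓝 p, Θ (Ψ y) = y := hΨs.eventually_left_inverse
  have hΨΘ : ∀ᶠ q in 𝓝 p, Ψ (Θ q) = q := by
    have := hΨs.eventually_right_inverse
    rwa [hΨp] at this
  have hΘp : Θ p = p := by simpa [hΨp] using hΘΨ.self_of_nhds
  have hΘt : Filter.Tendsto Θ (𝓝 p) (𝓝 p) := by
    simpa [hΘp] using hΘan.continuousAt.tendsto
  have hΨt : Filter.Tendsto Ψ (𝓝 p) (𝓝 p) := by
    simpa [hΨp] using hΨan.continuousAt.tendsto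
  have hπt : Filter.Tendsto π (𝓝 p) (𝓝 p) := by
    simpa [hπp] using (hπan p).continuousAt.tendsto
  have hgan : AnalyticAt 𝕜 (π ∘ Θ) p := (hπan _).comp hΘan
  have hgl : ∀ᶠ q in 𝓝 p, l q = l p → (π ∘ Θ) q = q := by
    filter_upwards [hΨl, hΘΨ] with q h1 h2 hq
    rw [h1 hq] at h2
    simp [h2, hπl q hq]
  refine ⟨π ∘ Θ, hgan, by simp [hΘp, hπp], .of_forall fun q => hlπ _, ?_, ?_, ?_⟩
  · have h : ∀ᶠ y in 𝓝 p, fderiv 𝕜 (π ∘ Θ) (Ψ y) (V (Ψ y)) = 0 := by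
      filter_upwards [hΘΨ.eventually_nhds, hΨt.eventually hgan.eventually_analyticAt,
        hΨan.eventually_analyticAt, hΨe] with y h1 h2 h3 h4
      have h5 := h2.differentiableAt.hasFDerivAt.comp y h3.differentiableAt.hasFDerivAt
      have h6 : (π ∘ Θ) ∘ Ψ =ᶠ[𝓝 y] π := h1.mono fun x hx => by simp [hx]
      have h7 := DFunLike.congr_fun (h5.unique ((hπ y).congr_of_eventuallyEq h6)) e
      rw [ContinuousLinearMap.comp_apply, h4, hπe] at h7
      exact h7
    filter_upwards [hΘt.eventually h, hΨΘ] with q h1 h2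
    rwa [h2] at h1
  · filter_upwards [hgl.eventually_nhds, hgan.eventually_analyticAt] with q h1 h2 hq w hw
    have h3 : HasDerivAt (fun s : 𝕜 => q + s • w) w 0 := by
      simpa using ((hasDerivAt_id (0 : 𝕜)).smul_const w).const_add q
    have h4 : HasFDerivAt (π ∘ Θ) (fderiv 𝕜 (π ∘ Θ) q) (q + (0 : 𝕜) • w) := by
      simpa using h2.differentiableAt.hasFDerivAt
    refine (h4.comp_hasDerivAt (0 : 𝕜) h3).unique (h3.congr_of_eventuallyEq ?_)
    have h5 : Filter.Tendsto (fun s : 𝕜 => q + s • w) (𝓝 0) (𝓝 q) := by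
      simpa using h3.continuousAt.tendsto
    filter_upwards [h5.eventually h1] with s hs
    exact hs (by simp [hq, hw])
  · intro h hh hhV
    have h1 : ∀ᶠ y in 𝓝 p, AnalyticAt 𝕜 (h ∘ Ψ) y ∧ fderiv 𝕜 (h ∘ Ψ) y e = 0 := by
      filter_upwards [hΨt.eventually hh.eventually_analyticAt, hΨan.eventually_analyticAt,
        hΨt.eventually hhV, hΨe] with y h2 h3 h4 h5
      refine ⟨h2.comp h3, ?_⟩
      rw [(h2.differentiableAt.hasFDerivAt.comp y h3.differentiableAt.hasFDerivAt).fderiv,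
        ContinuousLinearMap.comp_apply, h5, h4]
    obtain ⟨ρ, hρ, hball⟩ := Metric.eventually_nhds_iff_ball.1 h1
    have h2 : ∀ᶠ y in 𝓝 p, h (Ψ (π y)) = h (Ψ y) := by
      filter_upwards [Metric.ball_mem_nhds p hρ, hπt.eventually (Metric.ball_mem_nhds p hρ)]
        with y hy hy'
      have hd : ∀ s ∈ Set.Icc (0 : ℝ) 1,
          HasDerivAt (fun s : ℝ => (h ∘ Ψ) (y - s • l (y - p) • e)) 0 s := fun s hs => by
        have hmem : y - s • l (y - p) • e ∈ Metric.ball p ρ := by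
          have := (convex_ball p ρ).add_smul_sub_mem hy hy' hs
          simpa [π, sub_eq_add_neg] using this
        obtain ⟨h3, h4⟩ := hball _ hmem
        have h5 : HasDerivAt (fun s : ℝ => y - s • l (y - p) • e) (-(l (y - p) • e)) s := by
          simpa using ((hasDerivAt_id s).smul_const (l (y - p) • e)).const_sub y
        have h6 := (h3.differentiableAt.hasFDerivAt.restrictScalars ℝ).comp_hasDerivAt s h5
        rwa [ContinuousLinearMap.coe_restrictScalars', map_neg, map_smul, h4, smul_zero,
          neg_zero] at h6
      have h7 := constant_of_has_deriv_right_zero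
        (fun s hs => (hd s hs).continuousAt.continuousWithinAt)
        (fun s hs => (hd s (Set.Ico_subset_Icc_self hs)).hasDerivWithinAt) 1
        (Set.right_mem_Icc.2 zero_le_one)
      simpa [π] using h7
    have h3 : ∀ᶠ y in 𝓝 p, h (π y) = h (Ψ y) := by
      filter_upwards [h2, hπt.eventually hΨl] with y h4 h5
      rwa [h5 (hlπ y)] at h4
    filter_upwards [hΘt.eventually h3, hΨΘ] with q h4 h5
    rw [h5] at h4
    exact h4

/-- The coordinatewise inclusion of a real coordinate space in the complex one. -/
noncomputable def ofRealPiCLM (ι : Type*) [Fintype ι] : (ι → ℝ) →L[ℝ] (ι → ℂ) :=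
  ContinuousLinearMap.pi fun i => Complex.ofRealCLM.comp (.proj i)

@[simp]
theorem ofRealPiCLM_apply {ι : Type*} [Fintype ι] (x : ι → ℝ) (i : ι) :
    ofRealPiCLM ι x i = (x i : ℂ) := rfl

/-- A real analytic function of finitely many variables extends to a complex analytic one. -/
theorem AnalyticAt.exists_complex_extension {ι : Type*} [Fintype ι] [DecidableEq ι]
    {v : (ι → ℝ) → ℝ} {p : ι → ℝ} (hv : AnalyticAt ℝ v p) :
    ∃ w : (ι → ℂ) → ℂ, AnalyticAt ℂ w (ofRealPiCLM ι p) ∧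
      ∀ᶠ x in 𝓝 p, w (ofRealPiCLM ι x) = v x := by
  obtain ⟨P, r, hP⟩ := hv
  let b : ι → ι → ℝ := fun i => Pi.single i 1
  let q : FormalMultilinearSeries ℂ (ι → ℂ) ℂ := fun n =>
    ∑ k : Fin n → ι, (P n (fun j => b (k j)) : ℂ) •
      (ContinuousMultilinearMap.mkPiAlgebra ℂ (Fin n) ℂ).compContinuousLinearMap
        (fun j => ContinuousLinearMap.proj (R := ℂ) (φ := fun _ : ι => ℂ) (k j))
  have hq : ∀ n (x : ι → ℝ), q n (fun _ => ofRealPiCLM ι x) = (P n (fun _ => x) : ℂ) := by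
    intro n x
    have hx : (fun _ : Fin n => x) = fun _ => ∑ i, x i • b i := by
      ext _ i
      simp [b, Pi.single_apply]
    rw [hx, ContinuousMultilinearMap.map_sum]
    simp [q, ContinuousMultilinearMap.map_smul_univ, mul_comm]
  have hb : ∀ i, ‖b i‖ ≤ 1 := fun i => by simp [b, Pi.norm_single]
  have hnorm : ∀ n, ‖q n‖ ≤ (Fintype.card ι : ℝ) ^ n * ‖P n‖ := by
    intro n
    have h1 : ∀ k : Fin n → ι, ‖(P n (fun j => b (k j)) : ℂ) •
      (ContinuousMultilinearMap.mkPiAlgebra ℂ (Fin n) ℂ).compContinuousLinearMap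
        (fun j => ContinuousLinearMap.proj (R := ℂ) (φ := fun _ : ι => ℂ) (k j))‖ ≤ ‖P n‖ := by
      intro k
      rw [norm_smul, Complex.norm_real]
      have h2 : ‖P n (fun j => b (k j))‖ ≤ ‖P n‖ := by
        refine ((P n).le_opNorm _).trans (mul_le_of_le_one_right (norm_nonneg _) ?_)
        exact Finset.prod_le_one (fun _ _ => norm_nonneg _) fun j _ => hb _
      have h3 : ‖(ContinuousMultilinearMap.mkPiAlgebra ℂ (Fin n) ℂ).compContinuousLinearMap
          (fun j => ContinuousLinearMap.proj (R := ℂ) (φ := fun _ : ι => ℂ) (k j))‖ ≤ 1 := by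
        refine ContinuousMultilinearMap.opNorm_le_bound zero_le_one fun m => ?_
        simp only [ContinuousMultilinearMap.compContinuousLinearMap_apply,
          ContinuousMultilinearMap.mkPiAlgebra_apply, ContinuousLinearMap.proj_apply, norm_prod,
          one_mul]
        exact Finset.prod_le_prod (fun _ _ => norm_nonneg _) fun j _ => norm_le_pi_norm _ _
      calc _ ≤ ‖P n‖ * 1 := mul_le_mul h2 h3 (norm_nonneg _) (norm_nonneg _)
        _ = _ := mul_one _
    refine (norm_sum_le _ _).trans ((Finset.sum_le_sum fun k _ => h1 k).trans ?_)
    simp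
  obtain ⟨ρ, hρ0, hρ⟩ := ENNReal.lt_iff_exists_nnreal_btwn.1 (hP.r_pos.trans_le hP.r_le)
  have hrad : ((ρ / (Fintype.card ι + 1) : NNReal) : ENNReal) ≤ q.radius := by
    obtain ⟨C, -, hC⟩ := P.norm_mul_pow_le_of_lt_radius hρ
    refine q.le_radius_of_bound C fun n => le_trans ?_ (hC n)
    push_cast
    rw [div_pow, ← mul_div_assoc, div_le_iff₀ (by positivity)]
    calc ‖q n‖ * (ρ : ℝ) ^ n ≤ ((Fintype.card ι : ℝ) ^ n * ‖P n‖) * ρ ^ n := by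
          gcongr
          exact hnorm n
      _ ≤ (((Fintype.card ι : ℝ) + 1) ^ n * ‖P n‖) * ρ ^ n := by
          gcongr
          exact le_add_of_nonneg_right zero_le_one
      _ = _ := by ring
  have hr : 0 < q.radius := by
    refine lt_of_lt_of_le ?_ hrad
    have : 0 < ρ := by exact_mod_cast hρ0
    exact_mod_cast div_pos this (by positivity)
  have hsum := q.hasFPowerSeriesOnBall hr
  refine ⟨fun z => q.sum (z - ofRealPiCLM ι p), ?_, ?_⟩
  · have h := hsum.comp_sub (ofRealPiCLM ι p)
    rw [zero_add] at h
    exact h.analyticAt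
  · have ht : Filter.Tendsto (fun x => ofRealPiCLM ι (x - p)) (𝓝 p) (𝓝 0) := by
      have : Continuous fun x => ofRealPiCLM ι (x - p) := by fun_prop
      simpa using this.tendsto p
    filter_upwards [Metric.eball_mem_nhds p hP.r_pos,
      ht.eventually (Metric.eball_mem_nhds 0 hr)] with x hx hx'
    have h1 := hsum.hasSum hx'
    have h2 : x - p ∈ Metric.eball (0 : ι → ℝ) r := by
      simpa [edist_eq_enorm_sub] using hx
    have h3 := Complex.ofRealCLM.hasSum (hP.hasSum h2)
    simp only [add_sub_cancel, zero_add, hq] at h1 h3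
    rw [← map_sub]
    exact h1.unique h3

/-- The closed 2-form `dy ∧ dz + i dx ∧ dw` on `ℂ³` is locally a product `dF ∧ dG`. -/
theorem AnalyticAt.exists_wedge_eq_complex {w : (Fin 3 → ℂ) → ℂ} {c : Fin 3 → ℂ}
    (hw : AnalyticAt ℂ w c) :
    ∃ F G : (Fin 3 → ℂ) → ℂ, AnalyticAt ℂ F c ∧ AnalyticAt ℂ G c ∧
      ∀ᶠ q in 𝓝 c, ∀ a b : Fin 3 → ℂ,
        fderiv ℂ F q a * fderiv ℂ G q b - fderiv ℂ G q a * fderiv ℂ F q b =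
          (a 1 * b 2 - a 2 * b 1) +
            Complex.I * (a 0 * fderiv ℂ w q b - b 0 * fderiv ℂ w q a) := by
  let e : Fin 3 → Fin 3 → ℂ := fun i => Pi.single i 1
  have hexp : ∀ (L : (Fin 3 → ℂ) →L[ℂ] ℂ) (a : Fin 3 → ℂ),
      L a = a 0 * L (e 0) + a 1 * L (e 1) + a 2 * L (e 2) := by
    intro L a
    have ha : a = a 0 • e 0 + a 1 • e 1 + a 2 • e 2 := by
      ext i
      fin_cases i <;> simp [e]
    conv_lhs => rw [ha]
    simp
  let V : (Fin 3 → ℂ) → (Fin 3 → ℂ) := fun q =>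
    e 0 - (Complex.I * fderiv ℂ w q (e 2)) • e 1 + (Complex.I * fderiv ℂ w q (e 1)) • e 2
  have hpart : ∀ {f : (Fin 3 → ℂ) → ℂ} {q : Fin 3 → ℂ}, AnalyticAt ℂ f q → ∀ i,
      HasFDerivAt (fun q => fderiv ℂ f q (e i)) ((fderiv ℂ (fderiv ℂ f) q).flip (e i)) q := by
    intro f q hf i
    have h := hf.fderiv.differentiableAt.hasFDerivAt.clm_apply (hasFDerivAt_const (e i) q)
    simpa using h
  have hpartan : ∀ {f : (Fin 3 → ℂ) → ℂ}, AnalyticAt ℂ f c → ∀ i,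
      AnalyticAt ℂ (fun q => fderiv ℂ f q (e i)) c := fun hf i =>
    ((ContinuousLinearMap.apply ℂ ℂ (e i)).analyticAt _).fun_comp hf.fderiv
  have hV : AnalyticAt ℂ V c :=
    (analyticAt_const.sub ((analyticAt_const.mul (hpartan hw 2)).smul analyticAt_const)).add
      ((analyticAt_const.mul (hpartan hw 1)).smul analyticAt_const)
  let x : (Fin 3 → ℂ) →L[ℂ] ℂ := .proj 0
  obtain ⟨g, hg, hgc, hgx, hgV, hgid, hgconst⟩ :=
    hV.exists_analyticAt_flow_projection x (by simp [x, V, e])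
  let F : (Fin 3 → ℂ) → ℂ := fun q => g q 1
  let G : (Fin 3 → ℂ) → ℂ := fun q => g q 2
  have hcoord : ∀ i, AnalyticAt ℂ (fun q => g q i) c := fun i =>
    ((ContinuousLinearMap.proj (R := ℂ) (φ := fun _ : Fin 3 => ℂ) i).analyticAt _).fun_comp hg
  have hcoord' : ∀ᶠ q in 𝓝 c, ∀ i b, fderiv ℂ (fun q => g q i) q b = fderiv ℂ g q b i := by
    filter_upwards [hg.eventually_analyticAt] with q hq i b
    have h := (ContinuousLinearMap.proj (R := ℂ) (φ := fun _ : Fin 3 => ℂ) i).hasFDerivAt.comp q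
      hq.differentiableAt.hasFDerivAt
    exact DFunLike.congr_fun h.fderiv b
  have hFan : AnalyticAt ℂ F c := hcoord 1
  have hGan : AnalyticAt ℂ G c := hcoord 2
  have hFV : ∀ᶠ q in 𝓝 c, fderiv ℂ F q (V q) = 0 := by
    filter_upwards [hcoord', hgV] with q h1 h2
    rw [h1, h2]; rfl
  have hGV : ∀ᶠ q in 𝓝 c, fderiv ℂ G q (V q) = 0 := by
    filter_upwards [hcoord', hgV] with q h1 h2
    rw [h1, h2]; rfl
  let h : (Fin 3 → ℂ) → ℂ := fun q =>
    fderiv ℂ F q (e 1) * fderiv ℂ G q (e 2) - fderiv ℂ F q (e 2) * fderiv ℂ G q (e 1)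
  have hhan : AnalyticAt ℂ h c :=
    ((hpartan hFan 1).mul (hpartan hGan 2)).sub ((hpartan hFan 2).mul (hpartan hGan 1))
  have hdiff : ∀ f : (Fin 3 → ℂ) → ℂ, AnalyticAt ℂ f c →
      (∀ᶠ q in 𝓝 c, fderiv ℂ f q (V q) = 0) → ∀ᶠ q in 𝓝 c, ∀ i,
        fderiv ℂ (fderiv ℂ f) q (V q) (e i) =
          Complex.I * fderiv ℂ (fderiv ℂ w) q (e i) (e 2) * fderiv ℂ f q (e 1) -
            Complex.I * fderiv ℂ (fderiv ℂ w) q (e i) (e 1) * fderiv ℂ f q (e 2) := by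
    intro f hf hfV
    filter_upwards [hfV.eventually_nhds, hf.eventually_analyticAt, hw.eventually_analyticAt]
      with q h1 h2 h3 i
    have hV' := (((hpart h3 2).const_mul Complex.I).smul_const (e 1)).const_sub (e 0) |>.add
      (((hpart h3 1).const_mul Complex.I).smul_const (e 2))
    have h4 := h2.fderiv.differentiableAt.hasFDerivAt.clm_apply hV'
    have h5 := DFunLike.congr_fun
      (h4.unique ((hasFDerivAt_const (0 : ℂ) q).congr_of_eventuallyEq h1)) (e i)
    have h6 : IsSymmSndFDerivAt ℂ f q := h2.contDiffAt.isSymmSndFDerivAt_of_omega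
    have h7 : fderiv ℂ (fderiv ℂ f) q (e i) (V q) = fderiv ℂ (fderiv ℂ f) q (V q) (e i) :=
      h6 _ _
    simp at h5
    rw [← h7]
    simp only [V, map_add, map_sub, map_smul, smul_eq_mul]
    linear_combination h5
  have hhV : ∀ᶠ q in 𝓝 c, fderiv ℂ h q (V q) = 0 := by
    filter_upwards [hdiff F hFan hFV, hdiff G hGan hGV, hFan.eventually_analyticAt,
      hGan.eventually_analyticAt, hw.eventually_analyticAt] with q h1 h2 h3 h4 h5
    have h6 := ((hpart h3 1).mul (hpart h4 2)).sub ((hpart h3 2).mul (hpart h4 1))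
    have h7 : IsSymmSndFDerivAt ℂ w q := h5.contDiffAt.isSymmSndFDerivAt_of_omega
    have h8 := h7 (e 1) (e 2)
    have h9 : fderiv ℂ h q = _ := h6.fderiv
    rw [h9]
    simp [h1, h2, h8]
    ring
  have hh1 : ∀ᶠ q in 𝓝 c, h q = 1 := by
    have h1 : ∀ᶠ q in 𝓝 c, x q = x c → h q = 1 := by
      filter_upwards [hgid, hcoord'] with q h2 h3 hq
      have h4 : fderiv ℂ g q (e 1) = e 1 := h2 hq _ (by simp [x, e])
      have h5 : fderiv ℂ g q (e 2) = e 2 := h2 hq _ (by simp [x, e])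
      simp only [h, F, G, h3, h4, h5]
      simp [e]
    have hgt : Filter.Tendsto g (𝓝 c) (𝓝 c) := by
      simpa [hgc] using hg.continuousAt.tendsto
    filter_upwards [hgconst h hhan hhV, hgt.eventually h1, hgx] with q h2 h3 h4
    rw [← h2, h3 h4]
  refine ⟨F, G, hFan, hGan, ?_⟩
  filter_upwards [hh1, hFV, hGV] with q h1 h2 h3 a b
  simp only [V, map_add, map_sub, map_smul, smul_eq_mul] at h2 h3
  simp only [h] at h1
  rw [hexp (fderiv ℂ F q) a, hexp (fderiv ℂ F q) b, hexp (fderiv ℂ G q) a,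
    hexp (fderiv ℂ G q) b, hexp (fderiv ℂ w q) a, hexp (fderiv ℂ w q) b]
  generalize fderiv ℂ F q (e 0) = F0 at *
  generalize fderiv ℂ F q (e 1) = F1 at *
  generalize fderiv ℂ F q (e 2) = F2 at *
  generalize fderiv ℂ G q (e 0) = G0 at *
  generalize fderiv ℂ G q (e 1) = G1 at *
  generalize fderiv ℂ G q (e 2) = G2 at *
  generalize fderiv ℂ w q (e 1) = w1 at *
  generalize fderiv ℂ w q (e 2) = w2 at *
  have hF0 : F0 = Complex.I * w2 * F1 - Complex.I * w1 * F2 := by linear_combination h2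
  have hG0 : G0 = Complex.I * w2 * G1 - Complex.I * w1 * G2 := by linear_combination h3
  rw [hF0, hG0]
  linear_combination (a 1 * b 2 - a 2 * b 1 + Complex.I * w1 * (a 0 * b 1 - a 1 * b 0) +
    Complex.I * w2 * (a 0 * b 2 - a 2 * b 0)) * h1

/-- The real and imaginary parts of the product `dF ∧ dG` can be prescribed to be the closed
decomposable 2-forms `dy ∧ dz` and `dx ∧ dv` on `ℝ³`. -/
theorem AnalyticAt.exists_wedge_eq_real {v : (Fin 3 → ℝ) → ℝ} {c : Fin 3 → ℝ}
    (hv : AnalyticAt ℝ v c) :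
    ∃ F G : (Fin 3 → ℝ) → ℂ, AnalyticAt ℝ F c ∧ AnalyticAt ℝ G c ∧
      ∀ᶠ q in 𝓝 c, ∀ a b : Fin 3 → ℝ,
        fderiv ℝ F q a * fderiv ℝ G q b - fderiv ℝ G q a * fderiv ℝ F q b =
          ((a 1 * b 2 - a 2 * b 1 : ℝ) : ℂ) +
            Complex.I * ((a 0 * fderiv ℝ v q b - b 0 * fderiv ℝ v q a : ℝ) : ℂ) := by
  obtain ⟨w, hw, hwv⟩ := hv.exists_complex_extension
  obtain ⟨F, G, hF, hG, h⟩ := hw.exists_wedge_eq_complex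
  let ρ := ofRealPiCLM (Fin 3)
  have hρ : Filter.Tendsto ρ (𝓝 c) (𝓝 (ρ c)) := ρ.continuous.continuousAt
  have han : ∀ {f : (Fin 3 → ℂ) → ℂ}, AnalyticAt ℂ f (ρ c) → AnalyticAt ℝ (fun q => f (ρ q)) c :=
    fun hf => hf.restrictScalars.fun_comp (ρ.analyticAt c)
  have hder : ∀ {f : (Fin 3 → ℂ) → ℂ}, AnalyticAt ℂ f (ρ c) → ∀ᶠ q in 𝓝 c, ∀ a,
      fderiv ℝ (fun q => f (ρ q)) q a = fderiv ℂ f (ρ q) (ρ a) := by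
    intro f hf
    filter_upwards [hρ.eventually hf.eventually_analyticAt] with q hq a
    have h1 := (hq.differentiableAt.hasFDerivAt.restrictScalars ℝ).comp q ρ.hasFDerivAt
    exact DFunLike.congr_fun h1.fderiv a
  refine ⟨fun q => F (ρ q), fun q => G (ρ q), han hF, han hG, ?_⟩
  filter_upwards [hρ.eventually h, hder hF, hder hG, hder hw, hwv.eventually_nhds,
    hv.eventually_analyticAt] with q h1 h2 h3 h4 h5 h6 a b
  have h7 : ∀ a, fderiv ℂ w (ρ q) (ρ a) = ((fderiv ℝ v q a : ℝ) : ℂ) := by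
    intro a
    rw [← h4 a, Filter.EventuallyEq.fderiv_eq h5]
    exact DFunLike.congr_fun (Complex.ofRealCLM.hasFDerivAt.comp q
      h6.differentiableAt.hasFDerivAt).fderiv a
  rw [h2, h3, h2, h3, h1, h7, h7]
  simp [ρ]

/-- An analytic vector field `V` has an analytic local first integral with prescribed differential
at `p` among the functionals vanishing on `V p`. -/
theorem AnalyticAt.exists_first_integral {𝕜 E : Type*} [RCLike 𝕜]
    [NormedAddCommGroup E] [NormedSpace 𝕜 E] [NormedSpace ℝ E] [IsScalarTower ℝ 𝕜 E]
    [CompleteSpace E] {V : E → E} {p : E} (hV : AnalyticAt 𝕜 V p) {k l : E →L[𝕜] 𝕜}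
    (hk : k (V p) = 1) (hl : l (V p) = 0) :
    ∃ f : E → 𝕜, AnalyticAt 𝕜 f p ∧ fderiv 𝕜 f p = l ∧ ∀ᶠ q in 𝓝 p, fderiv 𝕜 f q (V q) = 0 := by
  obtain ⟨g, hg, -, -, hgV, hgid, -⟩ := hV.exists_analyticAt_flow_projection k hk
  have hf : ∀ q, AnalyticAt 𝕜 g q → fderiv 𝕜 (fun q => l (g q)) q = l.comp (fderiv 𝕜 g q) :=
    fun q hq => (l.hasFDerivAt.comp q hq.differentiableAt.hasFDerivAt).fderiv
  refine ⟨fun q => l (g q), (l.analyticAt _).fun_comp hg, ?_, ?_⟩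
  · rw [hf p hg]
    ext a
    have h1 := hgid.self_of_nhds rfl (a - k a • V p) (by simp [hk])
    rw [map_sub, map_smul, hgV.self_of_nhds, smul_zero, sub_zero] at h1
    simp [h1, hl]
  · filter_upwards [hg.eventually_analyticAt, hgV] with q h1 h2
    simp [hf q h1, h2]

/-- Functions with independent differentials at a point have independent differentials nearby. -/
theorem AnalyticAt.eventually_exists_fderiv_equiv {ι : Type*} [Fintype ι]
    {f : ι → (ι → ℝ) → ℝ} {p : ι → ℝ} (hf : ∀ i, AnalyticAt ℝ (f i) p)
    (hinj : ∀ a, (∀ i, fderiv ℝ (f i) p a = 0) → a = 0) :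
    ∀ᶠ q in 𝓝 p, ∃ e : (ι → ℝ) ≃L[ℝ] (ι → ℝ), ∀ a i, e a i = fderiv ℝ (f i) q a := by
  let χ : (ι → ℝ) → (ι → ℝ) := fun q i => f i q
  have hχ : AnalyticAt ℝ χ p := .pi hf
  have hder : ∀ᶠ q in 𝓝 p, ∀ a i, fderiv ℝ χ q a i = fderiv ℝ (f i) q a := by
    filter_upwards [Filter.eventually_all.2 fun i => (hf i).eventually_analyticAt] with q hq a i
    rw [fderiv_pi fun i => (hq i).differentiableAt]
    rfl
  let e₀ : (ι → ℝ) ≃L[ℝ] (ι → ℝ) :=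
    (LinearEquiv.ofInjectiveEndo (fderiv ℝ χ p : (ι → ℝ) →ₗ[ℝ] (ι → ℝ))
      ((injective_iff_map_eq_zero _).2 fun a ha => hinj a fun i => by
        rw [← hder.self_of_nhds]
        exact congr_fun ha i)).toContinuousLinearEquiv
  have he₀ : (e₀ : (ι → ℝ) →L[ℝ] (ι → ℝ)) = fderiv ℝ χ p := by
    ext a : 1
    rfl
  filter_upwards [hder, hχ.fderiv.continuousAt.tendsto (he₀ ▸ e₀.nhds)] with q h1 ⟨e, h2⟩
  refine ⟨e, fun a i => ?_⟩
  rw [← h1, ← h2]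
  rfl

/-- The kernel of the product of two of three independent functionals. -/
theorem ContinuousLinearEquiv.span_singleton_eq_wedge_kernel {E : Type*} [NormedAddCommGroup E]
    [NormedSpace ℝ E] (e : E ≃L[ℝ] (Fin 3 → ℝ)) {X : E} (hX : X ≠ 0) (h1 : e X 1 = 0)
    (h2 : e X 2 = 0) :
    (Submodule.span ℝ {X} : Set E) = {a | ∀ b, e a 1 * e b 2 - e a 2 * e b 1 = 0} := by
  ext a
  simp only [SetLike.mem_coe, Submodule.mem_span_singleton, Set.mem_ofPred_eq]
  constructor
  · rintro ⟨t, rfl⟩ b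
    simp [h1, h2]
  · intro h
    have ha1 : e a 1 = 0 := by simpa using h (e.symm (Pi.single 2 1))
    have ha2 : e a 2 = 0 := by simpa using h (e.symm (Pi.single 1 1))
    have h0 : e X 0 ≠ 0 := fun h0 => hX <| e.injective <| by
      ext i
      fin_cases i <;> simp [h0, h1, h2]
    refine ⟨e a 0 / e X 0, e.injective ?_⟩
    ext i
    fin_cases i <;> simp [h0, h1, h2, ha1, ha2]

/-- Two independent line fields on `ℝ³`, locally spanned by analytic vector fields `X` and `Y`, are
the kernels of the real and imaginary parts of a pulled back `dz¹ ∧ dz²`. -/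
theorem AnalyticAt.exists_span_eq_kernel {X Y : (Fin 3 → ℝ) → (Fin 3 → ℝ)} {p Z : Fin 3 → ℝ}
    (hX : AnalyticAt ℝ X p) (hY : AnalyticAt ℝ Y p)
    (hXYZ : LinearIndependent ℝ ![X p, Y p, Z]) :
    ∃ φ : (Fin 3 → ℝ) → (Fin 2 → ℂ), AnalyticAt ℝ φ p ∧ ∀ᶠ q in 𝓝 p,
      (Submodule.span ℝ {X q} : Set (Fin 3 → ℝ)) =
        {v | ∀ w, omegaC (fderiv ℝ φ q v) (fderiv ℝ φ q w) = 0} ∧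
      (Submodule.span ℝ {Y q} : Set (Fin 3 → ℝ)) =
        {v | ∀ w, phiC (fderiv ℝ φ q v) (fderiv ℝ φ q w) = 0} := by
  let B := basisOfLinearIndependentOfCardEqFinrank hXYZ (by simp)
  have hB : ∀ i, B i = ![X p, Y p, Z] i := fun i => by simp [B]
  let l : Fin 3 → (Fin 3 → ℝ) →L[ℝ] ℝ := fun i => (B.coord i).toContinuousLinearMap
  have hl : ∀ i j, l i (![X p, Y p, Z] j) = if j = i then 1 else 0 := by
    intro i j
    rw [← hB]
    simp [l, Finsupp.single_apply]
  have hl0 : ∀ a, l 0 a = 0 → l 1 a = 0 → l 2 a = 0 → a = 0 := fun a h0 h1 h2 =>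
    B.ext_elem fun i => by
      rw [map_zero, Finsupp.zero_apply]
      fin_cases i <;> assumption
  obtain ⟨u₁, hu₁, hu₁p, hu₁X⟩ := hX.exists_first_integral (hl 0 0) (hl 1 0)
  obtain ⟨u₂, hu₂, hu₂p, hu₂X⟩ := hX.exists_first_integral (hl 0 0) (hl 2 0)
  obtain ⟨v₁, hv₁, hv₁p, hv₁Y⟩ := hY.exists_first_integral (hl 1 1) (hl 0 1)
  obtain ⟨v₂, hv₂, hv₂p, hv₂Y⟩ := hY.exists_first_integral (hl 1 1) (hl 2 1)
  let f : Fin 3 → (Fin 3 → ℝ) → ℝ := ![v₁, u₁, u₂]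
  have hf : ∀ i, AnalyticAt ℝ (f i) p := fun i => by fin_cases i <;> assumption
  have hfe := AnalyticAt.eventually_exists_fderiv_equiv hf fun a ha => hl0 a
    (by simpa [f, hv₁p] using ha 0) (by simpa [f, hu₁p] using ha 1) (by simpa [f, hu₂p] using ha 2)
  have hge := AnalyticAt.eventually_exists_fderiv_equiv (f := ![u₁, v₁, v₂]) (p := p)
    (fun i => by fin_cases i <;> assumption) fun a ha => hl0 a
    (by simpa [hv₁p] using ha 1) (by simpa [hu₁p] using ha 0) (by simpa [hv₂p] using ha 2)
  let χ : (Fin 3 → ℝ) → (Fin 3 → ℝ) := fun q i => f i q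
  have hχ : AnalyticAt ℝ χ p := .pi hf
  have hχd : ∀ᶠ q in 𝓝 p, AnalyticAt ℝ χ q ∧ ∀ a i, fderiv ℝ χ q a i = fderiv ℝ (f i) q a := by
    filter_upwards [Filter.eventually_all.2 fun i => (hf i).eventually_analyticAt] with q hq
    refine ⟨.pi hq, fun a i => ?_⟩
    rw [fderiv_pi fun i => (hq i).differentiableAt]
    rfl
  obtain ⟨e₀, he₀⟩ := hfe.self_of_nhds
  have hχe₀ : fderiv ℝ χ p = e₀ := ContinuousLinearMap.ext fun a => funext fun i =>
    (hχd.self_of_nhds.2 _ _).trans (he₀ _ _).symm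
  have hχe : HasFDerivAt χ (e₀ : (Fin 3 → ℝ) →L[ℝ] (Fin 3 → ℝ)) p :=
    hχe₀ ▸ hχ.differentiableAt.hasFDerivAt
  have hχω : ContDiffAt ℝ ω χ p := hχ.contDiffAt
  let κ := hχω.localInverse hχe (by simp)
  have hκ : AnalyticAt ℝ κ (χ p) := (hχω.to_localInverse hχe (by simp)).analyticAt
  have hκp : κ (χ p) = p := hχω.localInverse_apply_image hχe (by simp)
  have hκχ : ∀ᶠ q in 𝓝 p, κ (χ q) = q :=
    (hχω.hasStrictFDerivAt' hχe (by simp)).eventually_left_inverse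
  let v : (Fin 3 → ℝ) → ℝ := fun y => v₂ (κ y)
  have hv : AnalyticAt ℝ v (χ p) := by
    refine AnalyticAt.fun_comp ?_ hκ
    rwa [hκp]
  obtain ⟨F, G, hF, hG, hFG⟩ := hv.exists_wedge_eq_real
  have hχt : Filter.Tendsto χ (𝓝 p) (𝓝 (χ p)) := hχ.continuousAt
  have hcomp : ∀ {H : (Fin 3 → ℝ) → ℂ}, AnalyticAt ℝ H (χ p) → ∀ᶠ q in 𝓝 p,
      HasFDerivAt (fun q => H (χ q)) ((fderiv ℝ H (χ q)).comp (fderiv ℝ χ q)) q := by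
    intro H hH
    filter_upwards [hχd, hχt.eventually hH.eventually_analyticAt] with q h1 h2
    exact h2.differentiableAt.hasFDerivAt.comp q h1.1.differentiableAt.hasFDerivAt
  have hvχ : ∀ᶠ q in 𝓝 p, ∀ a, fderiv ℝ v (χ q) (fderiv ℝ χ q a) = fderiv ℝ v₂ q a := by
    filter_upwards [hχd, hχt.eventually hv.eventually_analyticAt, hκχ.eventually_nhds]
      with q h1 h2 h3 a
    have h4 := h2.differentiableAt.hasFDerivAt.comp q h1.1.differentiableAt.hasFDerivAt
    have h5 : v ∘ χ =ᶠ[𝓝 q] v₂ := h3.mono fun x hx => congr_arg v₂ hx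
    rw [← h5.fderiv_eq, h4.fderiv]
    rfl
  let φ : (Fin 3 → ℝ) → (Fin 2 → ℂ) := fun q => ![F (χ q), G (χ q)]
  have hXne : ∀ᶠ q in 𝓝 p, X q ≠ 0 := hX.continuousAt.eventually_ne (hXYZ.ne_zero 0)
  have hYne : ∀ᶠ q in 𝓝 p, Y q ≠ 0 := hY.continuousAt.eventually_ne (hXYZ.ne_zero 1)
  refine ⟨φ, .pi fun i => ?_, ?_⟩
  · fin_cases i
    exacts [hF.fun_comp hχ, hG.fun_comp hχ]
  filter_upwards [hχt.eventually hFG, hcomp hF, hcomp hG, hvχ, hχd, hfe, hge, hXne, hYne, hu₁X,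
    hu₂X, hv₁Y, hv₂Y] with q hFGq hFq hGq hvq hχq ⟨e, he⟩ ⟨e', he'⟩ hXq hYq h1 h2 h3 h4
  have hφq : HasFDerivAt φ (.pi ![(fderiv ℝ F (χ q)).comp (fderiv ℝ χ q),
      (fderiv ℝ G (χ q)).comp (fderiv ℝ χ q)]) q := hasFDerivAt_pi.2 fun i => by
    fin_cases i
    exacts [hFq, hGq]
  have hφ0 : ∀ a, fderiv ℝ φ q a 0 = fderiv ℝ F (χ q) (fderiv ℝ χ q a) := fun a => by
    rw [hφq.fderiv]
    rfl
  have hφ1 : ∀ a, fderiv ℝ φ q a 1 = fderiv ℝ G (χ q) (fderiv ℝ χ q a) := fun a => by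
    rw [hφq.fderiv]
    rfl
  have hform : ∀ a b, fderiv ℝ φ q a 0 * fderiv ℝ φ q b 1 - fderiv ℝ φ q a 1 * fderiv ℝ φ q b 0 =
      ((e a 1 * e b 2 - e a 2 * e b 1 : ℝ) : ℂ) +
        Complex.I * ((e' a 1 * e' b 2 - e' a 2 * e' b 1 : ℝ) : ℂ) := by
    intro a b
    rw [hφ0, hφ0, hφ1, hφ1, hFGq]
    simp only [hvq, hχq.2, he, he']
    simp [f]
    ring
  constructor
  · rw [e.span_singleton_eq_wedge_kernel hXq (by simpa [he, f] using h1)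
      (by simpa [he, f] using h2)]
    simp [omegaC, hform]
  · rw [e'.span_singleton_eq_wedge_kernel hYq (by simpa [he'] using h3)
      (by simpa [he'] using h4)]
    simp [phiC, hform]

/-- Vectors spanning two independent lines, together with a vector outside of their sum, are
linearly independent. -/
theorem linearIndependent_triple_of_notMem_sup {K E : Type*} [Field K] [AddCommGroup E]
    [Module K E] {x y z : E} (hx : x ≠ 0) (hy : y ≠ 0)
    (hxy : Submodule.span K {x} ⊓ Submodule.span K {y} = ⊥)
    (hz : z ∉ Submodule.span K {x} ⊔ Submodule.span K {y}) : LinearIndependent K ![x, y, z] := by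
  rw [Fintype.linearIndependent_iff]
  intro g hg
  simp only [Fin.sum_univ_three, Matrix.cons_val] at hg
  have hmx : ∀ t : K, t • x ∈ Submodule.span K {x} := fun t =>
    Submodule.smul_mem _ t (Submodule.mem_span_singleton_self x)
  have hmy : ∀ t : K, t • y ∈ Submodule.span K {y} := fun t =>
    Submodule.smul_mem _ t (Submodule.mem_span_singleton_self y)
  have h2 : g 2 = 0 := by
    by_contra h2
    refine hz ((Submodule.smul_mem_iff _ h2).1 ?_)
    rw [← neg_eq_of_add_eq_zero_right hg]
    exact neg_mem (Submodule.add_mem_sup (hmx _) (hmy _))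
  rw [h2, zero_smul, add_zero] at hg
  have hx0 : g 0 • x = 0 := by
    rw [← Submodule.mem_bot K, ← hxy]
    refine ⟨hmx _, ?_⟩
    rw [eq_neg_of_add_eq_zero_left hg]
    exact neg_mem (hmy _)
  rw [hx0, zero_add] at hg
  intro i
  fin_cases i
  exacts [(smul_eq_zero.1 hx0).resolve_right hx, (smul_eq_zero.1 hg).resolve_right hy, h2]

/-- An immersion is locally an embedding. -/
theorem HasStrictFDerivAt.exists_nhds_isEmbedding_restrict {E F : Type*} [NormedAddCommGroup E]
    [NormedSpace ℝ E] [FiniteDimensional ℝ E] [NormedAddCommGroup F] [NormedSpace ℝ F]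
    [FiniteDimensional ℝ F] {f : E → F} {f' : E →L[ℝ] F} {p : E} (hf : HasStrictFDerivAt f f' p)
    (hinj : Function.Injective f') :
    ∃ W ∈ 𝓝 p, ∀ s ⊆ W, ContinuousOn f s → Topology.IsEmbedding (s.domRestrict f) := by
  have : CompleteSpace E := FiniteDimensional.complete ℝ E
  obtain ⟨T, hT⟩ := (f' : E →ₗ[ℝ] F).exists_leftInverse_of_injective (LinearMap.ker_eq_bot.2 hinj)
  let T' : F →L[ℝ] E := T.toContinuousLinearMap
  have hTf : HasStrictFDerivAt (fun x => T' (f x)) (ContinuousLinearEquiv.refl ℝ E : E →L[ℝ] E)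
      p := by
    convert T'.hasStrictFDerivAt.comp p hf using 1
    ext x
    exact (LinearMap.congr_fun hT x).symm
  let e := hTf.toOpenPartialHomeomorph
  refine ⟨e.source, e.open_source.mem_nhds hTf.mem_toOpenPartialHomeomorph_source,
    fun s hs hfs => ?_⟩
  exact .of_comp hfs.domRestrict T'.continuous
    (e.isEmbedding_restrict.comp (Topology.IsEmbedding.inclusion hs))

end

/-- local embeddability of real analytic path geometries: let
`(M, P₁, P₂)` be a real analytic path geometry on a `3`-manifold — modelled, since the
statement is purely local, on an open set `U ⊆ ℝ³`: `P₁, P₂` are line fields which are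
real analytic (locally spanned by nonvanishing real analytic vector fields `X, Y`) and
span a contact plane field (`P₁ ⊕ P₂` with `[X,Y] ∉ P₁ ⊕ P₂`).  Then every `p ∈ U`
has an open neighbourhood `U_p` and a real analytic embedding `φ : U_p → ℂ²` such that
the path geometry induced by the splitting `({ω₀},{φ₀})` is `(P₁, P₂)` on `U_p`;
equivalently (via adapted coframings), `P₁` is the kernel of `φ*ω₀` and `P₂` is the
kernel of `φ*φ₀`. -/
theorem stmt13
    (U : Set (Fin 3 → ℝ)) (hU : IsOpen U)
    (P₁ P₂ : (Fin 3 → ℝ) → Submodule ℝ (Fin 3 → ℝ))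
    (hpg : ∀ p ∈ U, ∃ r > (0 : ℝ), Metric.ball p r ⊆ U ∧
      ∃ X Y : (Fin 3 → ℝ) → (Fin 3 → ℝ),
        AnalyticOnNhd ℝ X (Metric.ball p r) ∧ AnalyticOnNhd ℝ Y (Metric.ball p r) ∧
        ∀ q ∈ Metric.ball p r,
          X q ≠ 0 ∧ Y q ≠ 0 ∧
          P₁ q = Submodule.span ℝ {X q} ∧ P₂ q = Submodule.span ℝ {Y q} ∧
          P₁ q ⊓ P₂ q = ⊥ ∧
          VectorField.lieBracket ℝ X Y q ∉ P₁ q ⊔ P₂ q) :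
    ∀ p ∈ U, ∃ Up : Set (Fin 3 → ℝ), IsOpen Up ∧ p ∈ Up ∧ Up ⊆ U ∧
      ∃ φ : (Fin 3 → ℝ) → (Fin 2 → ℂ),
        AnalyticOnNhd ℝ φ Up ∧
        Set.InjOn φ Up ∧
        (∀ q ∈ Up, Function.Injective (fderiv ℝ φ q)) ∧
        Topology.IsEmbedding (Up.restrict φ) ∧
        ∀ q ∈ Up,
          ((P₁ q : Set (Fin 3 → ℝ)) =
            {v | ∀ w, omegaC (fderiv ℝ φ q v) (fderiv ℝ φ q w) = 0}) ∧
          ((P₂ q : Set (Fin 3 → ℝ)) =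
            {v | ∀ w, phiC (fderiv ℝ φ q v) (fderiv ℝ φ q w) = 0}) := by
  intro p hp
  obtain ⟨r, hr, hrU, X, Y, hX, hY, h⟩ := hpg p hp
  have hpr : p ∈ Metric.ball p r := Metric.mem_ball_self hr
  have hXYZ : LinearIndependent ℝ ![X p, Y p, VectorField.lieBracket ℝ X Y p] := by
    obtain ⟨hX0, hY0, h₁, h₂, h₁₂, hZ⟩ := h p hpr
    rw [h₁, h₂] at h₁₂ hZ
    exact linearIndependent_triple_of_notMem_sup hX0 hY0 h₁₂ hZ
  obtain ⟨φ, hφ, hker⟩ := (hX p hpr).exists_span_eq_kernel (hY p hpr) hXYZ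
  have hgood : ∀ᶠ q in nhds p, AnalyticAt ℝ φ q ∧ Function.Injective (fderiv ℝ φ q) ∧
      ((P₁ q : Set (Fin 3 → ℝ)) = {v | ∀ w, omegaC (fderiv ℝ φ q v) (fderiv ℝ φ q w) = 0}) ∧
      ((P₂ q : Set (Fin 3 → ℝ)) = {v | ∀ w, phiC (fderiv ℝ φ q v) (fderiv ℝ φ q w) = 0}) := by
    filter_upwards [hφ.eventually_analyticAt, hker, Metric.ball_mem_nhds p hr] with q h1 h2 h3
    obtain ⟨-, -, h₁, h₂, h₁₂, -⟩ := h q h3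
    rw [← h₁, ← h₂] at h2
    refine ⟨h1, (injective_iff_map_eq_zero _).2 fun a ha => ?_, h2⟩
    have ha₁ : a ∈ (P₁ q : Set (Fin 3 → ℝ)) := by
      rw [h2.1]
      simp [ha, omegaC]
    have ha₂ : a ∈ (P₂ q : Set (Fin 3 → ℝ)) := by
      rw [h2.2]
      simp [ha, phiC]
    simpa [h₁₂] using Submodule.mem_inf.2 ⟨ha₁, ha₂⟩
  obtain ⟨W, hW, hemb⟩ := hφ.hasStrictFDerivAt.exists_nhds_isEmbedding_restrict
    hgood.self_of_nhds.2.1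
  obtain ⟨V, hV, hVo, hpV⟩ := mem_nhds_iff.1
    (Filter.inter_mem (Filter.inter_mem hgood hW) (Metric.ball_mem_nhds p hr))
  have hφV : AnalyticOnNhd ℝ φ V := fun q hq => (hV hq).1.1.1
  have hVemb := hemb V (fun q hq => (hV hq).1.2) hφV.continuousOn
  exact ⟨V, hVo, hpV, fun q hq => hrU (hV hq).2, φ, hφV, Set.injOn_iff_injective.2 hVemb.injective,
    fun q hq => (hV hq).1.1.2.1, hVemb, fun q hq => (hV hq).1.1.2.2⟩
end
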